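/- arXiv:1301.1934 — 7 statements merged into one kernel-verified Lean document; each statement's English description precedes it below -/
import Mathlib

section
/- Let K : (0,∞)² → [0,∞) be symmetric and measurable with K(x,y) ≤ K̄ for all x,y and some constant K̄ > 0; let F : (0,∞) → [0,∞) be measurable with F(x) ≤ F̄ for some constant F̄ > 0; let β be a nonnegative measure on Θ with β(Θ) < ∞, β({θ ∈ Θ : ∑_{k≥1} θ_k > 1}) = 0, and β({θ ∈ Θ : θ_{k+1} > 0}) = 0 for some k ∈ ℕ (so β-a.e. dislocation produces at most k fragments). Let μ^in be a finite nonnegative Borel measure on (0,∞). Then there exists a unique family (μ_t)_{t≥0} of finite nonnegative Borel measures on (0,∞) such that μ₀ = μ^in and for every bounded measurable φ : (0,∞) → ℝ the map t ↦ ∫₀^∞ φ(x) μ_t(dx) is differentiable with (d/dt)∫₀^∞ φ(x) μ_t(dx) = ∫₀^∞∫₀^∞ K(x,y)[(1/2)φ(x+y) − φ(x)] μ_t(dy) μ_t(dx) + ∫₀^∞ F(x) ∫_Θ [∑_{i≥1} φ(θ_i x) − φ(x)] β(dθ) μ_t(dx). Moreover this solution satisfies, for every t ≥ 0, sup_{s∈[0,t]}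 μ_s((0,∞)) ≤ C_t · μ^in((0,∞)), where C_t is a constant depending only on t, K̄, F̄ and β (one may take C_t = exp(F̄(k−1)β(Θ)t)). -/
open MeasureTheory
open scoped ENNReal

/-- The set Θ of dislocation configurations: sequences θ with 1 > θ₁ ≥ θ₂ ≥ ⋯ ≥ 0,
indexed from 0 (`θ 0` is θ₁), with the Borel σ-algebra inherited from the product. -/
def DislocationSpace : Type :=
  {θ : ℕ → ℝ // θ 0 < 1 ∧ Antitone θ ∧ ∀ k, 0 ≤ θ k}

instance : MeasurableSpace DislocationSpace :=
  Subtype.instMeasurableSpace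

/-- `(μ_t)_{t≥0}` is a weak solution of the coagulation multi-fragmentation equation
with bounded kernels: the measures are finite, carried by (0,∞), μ₀ = μ^in, and for
every bounded measurable test function φ the map t ↦ ∫φ dμ_t is differentiable on
[0,∞) with the prescribed derivative (in the weak form using the operators
(Ãφ)(x,y) = K(x,y)((1/2)φ(x+y) − φ(x)) and (Lφ)(x) = F(x)∫_Θ(∑φ(θ_ix) − φ(x))β(dθ);
in the fragmentation sum only the nonzero fragments θ_i x > 0 contribute). -/
def IsWeakSolutionBdd (K : ℝ → ℝ → ℝ) (F : ℝ → ℝ)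
    (β : Measure DislocationSpace) (μin : Measure ℝ) (μ : ℝ → Measure ℝ) : Prop :=
  μ 0 = μin ∧
  (∀ t : ℝ, 0 ≤ t → IsFiniteMeasure (μ t) ∧ μ t (Set.Iic 0) = 0) ∧
  (∀ φ : ℝ → ℝ, Measurable φ → (∃ Cφ : ℝ, ∀ x : ℝ, |φ x| ≤ Cφ) →
    ∀ t : ℝ, 0 ≤ t →
      HasDerivWithinAt (fun s => ∫ x in Set.Ioi (0 : ℝ), φ x ∂(μ s))
        ((∫ x in Set.Ioi (0 : ℝ),
            (∫ y in Set.Ioi (0 : ℝ),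
              K x y * ((1 / 2) * φ (x + y) - φ x) ∂(μ t)) ∂(μ t))
          + ∫ x in Set.Ioi (0 : ℝ),
              F x * ∫ θ : DislocationSpace,
                ((∑' i : ℕ, if 0 < θ.1 i * x then φ (θ.1 i * x) else 0) - φ x)
                  ∂β ∂(μ t))
        (Set.Ici 0) t)

namespace CoagFrag

open Set Filter Topology ProbabilityTheory

section General

variable {X : Type*} [MeasurableSpace X]

/-- Two measures differ by at most `d` on every measurable set. -/
def SetwiseClose (p q : Measure X) (d : ℝ) : Prop :=
  ∀ A, MeasurableSet A → |p.real A - q.real A| ≤ d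

theorem integrable_of_abs_le {p : Measure X} [IsFiniteMeasure p] {φ : X → ℝ}
    (hφ : Measurable φ) {c : ℝ} (hc : ∀ x, |φ x| ≤ c) : Integrable φ p :=
  Integrable.of_bound hφ.aestronglyMeasurable c (ae_of_all _ hc)

theorem abs_integral_le_of_abs_le {p : Measure X} [IsFiniteMeasure p] {φ : X → ℝ}
    {c : ℝ} (hc : ∀ x, |φ x| ≤ c) : |∫ x, φ x ∂p| ≤ c * p.real univ := by
  simpa using norm_integral_le_of_norm_le_const (μ := p) (f := φ) (C := c) (ae_of_all _ hc)

theorem SetwiseClose.abs_integral_sub_le {p q : Measure X} [IsFiniteMeasure p]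
    [IsFiniteMeasure q] {d : ℝ} (h : SetwiseClose p q d) {φ : X → ℝ} (hφ : Measurable φ)
    {c : ℝ} (hc0 : 0 ≤ c) (hc : ∀ x, |φ x| ≤ c) :
    |∫ x, φ x ∂p - ∫ x, φ x ∂q| ≤ 3 * c * d := by
  have layer : ∀ (m : Measure X) [IsFiniteMeasure m],
      ∫ x, φ x ∂m = (∫ t in Ioc 0 (2 * c), m.real {a | t ≤ φ a + c}) - c * m.real univ := by
    intro m _
    have hint := integrable_of_abs_le (p := m) hφ hc
    rw [← Integrable.integral_eq_integral_Ioc_meas_le (f := fun a => φ a + c)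
      (hint.add (integrable_const c))
      (ae_of_all _ fun x => by have := abs_le.1 (hc x); simp only [Pi.zero_apply]; linarith)
      (ae_of_all _ fun x => by have := abs_le.1 (hc x); simp only; linarith)]
    rw [integral_add hint (integrable_const c)]
    simp [mul_comm]
  have hanti : ∀ (m : Measure X) [IsFiniteMeasure m],
      IntegrableOn (fun t => m.real {a | t ≤ φ a + c}) (Ioc 0 (2 * c)) := by
    intro m _
    refine Integrable.of_bound (C := m.real univ) (Antitone.measurable ?_).aestronglyMeasurable
      (ae_of_all _ fun t => ?_)
    · intro s t hst
      exact measureReal_mono fun a (ha : t ≤ φ a + c) => hst.trans ha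
    · rw [Real.norm_of_nonneg measureReal_nonneg]
      exact measureReal_mono (subset_univ _)
  have h1 : |(∫ t in Ioc 0 (2 * c), p.real {a | t ≤ φ a + c})
      - ∫ t in Ioc 0 (2 * c), q.real {a | t ≤ φ a + c}| ≤ d * (2 * c) := by
    rw [← integral_sub (hanti p) (hanti q)]
    have := norm_setIntegral_le_of_norm_le_const (μ := volume) (s := Ioc 0 (2 * c)) (C := d)
      (f := fun t => p.real {a | t ≤ φ a + c} - q.real {a | t ≤ φ a + c}) measure_Ioc_lt_top
      (fun t _ => h _ (measurableSet_le measurable_const (hφ.add_const c)))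
    simpa [hc0] using this
  have h2 := h univ MeasurableSet.univ
  rw [layer p, layer q]
  rw [abs_le] at h1 h2 ⊢
  constructor <;> nlinarith

/-- A sequence of finite measures which is geometrically Cauchy, uniformly on measurable sets,
converges uniformly on measurable sets. -/
theorem exists_measure_setwiseClose (v : ℕ → Measure X) [∀ n, IsFiniteMeasure (v n)] (C : ℝ)
    (h : ∀ n, SetwiseClose (v n) (v (n + 1)) (C / 2 / 2 ^ n)) :
    ∃ w : Measure X, IsFiniteMeasure w ∧ ∀ n, SetwiseClose (v n) w (C / 2 ^ n) := by
  have hlim : ∀ A, ∃ l, MeasurableSet A → Tendsto (fun n => (v n).real A) atTop (𝓝 l) := by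
    intro A
    by_cases hA : MeasurableSet A
    · obtain ⟨l, hl⟩ := cauchySeq_tendsto_of_complete
        (cauchySeq_of_le_geometric_two (f := fun n => (v n).real A) fun n => h n A hA)
      exact ⟨l, fun _ => hl⟩
    · exact ⟨0, fun h => absurd h hA⟩
  choose l hl using hlim
  have hclose : ∀ n A, MeasurableSet A → |(v n).real A - l A| ≤ C / 2 ^ n := fun n A hA =>
    dist_le_of_le_geometric_two_of_tendsto (fun n => h n A hA) (hl A hA) n
  have hnn : ∀ A, MeasurableSet A → 0 ≤ l A := fun A hA =>
    ge_of_tendsto' (hl A hA) fun n => measureReal_nonneg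
  have hempty : l ∅ = 0 := tendsto_nhds_unique (hl ∅ MeasurableSet.empty) (by simp)
  have hsum : ∀ A : ℕ → Set X, (∀ i, MeasurableSet (A i)) → Pairwise (Function.onFun Disjoint A) →
      HasSum (fun i => l (A i)) (l (⋃ i, A i)) := by
    intro A hA hd
    rw [hasSum_iff_tendsto_nat_of_nonneg fun i => hnn _ (hA i)]
    have hfin : ∀ n N, ∑ i ∈ Finset.range N, (v n).real (A i)
        = (v n).real (⋃ i ∈ Finset.range N, A i) := fun n N =>
      (measureReal_biUnion_finset (fun i _ j _ hij => hd hij) fun i _ => hA i).symm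
    have hU : ∀ N, MeasurableSet (⋃ i ∈ Finset.range N, A i) := fun N =>
      Finset.measurableSet_biUnion _ fun i _ => hA i
    have hl_fin : ∀ N, ∑ i ∈ Finset.range N, l (A i) = l (⋃ i ∈ Finset.range N, A i) := by
      intro N
      refine tendsto_nhds_unique (tendsto_finsetSum _ fun i _ => hl (A i) (hA i)) ?_
      simp_rw [hfin]
      exact hl _ (hU N)
    refine TendstoUniformly.tendsto_of_eventually_tendsto
      (F := fun n N => ∑ i ∈ Finset.range N, (v n).real (A i)) (p := atTop)
      (L := fun n => (v n).real (⋃ i, A i)) ?_ (Eventually.of_forall fun n => ?_)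
      (hl _ (MeasurableSet.iUnion hA))
    · rw [Metric.tendstoUniformly_iff]
      intro ε hε
      have h0 : Tendsto (fun n : ℕ => C / 2 ^ n) atTop (𝓝 0) :=
        tendsto_const_nhds.div_atTop (tendsto_pow_atTop_atTop_of_one_lt one_lt_two)
      filter_upwards [h0.eventually (gt_mem_nhds hε)] with n hn N
      rw [hl_fin, hfin, dist_comm]
      exact (hclose n _ (hU N)).trans_lt hn
    · have h1 : HasSum (fun i => v n (A i)) (v n (⋃ i, A i)) :=
        measure_iUnion hd hA ▸ ENNReal.summable.hasSum
      have h2 := (ENNReal.tendsto_toReal (measure_ne_top (v n) (⋃ i, A i))).comp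
        h1.tendsto_sum_nat
      refine h2.congr fun N => ?_
      exact ENNReal.toReal_sum fun i _ => measure_ne_top _ _
  refine ⟨Measure.ofMeasurable (fun A _ => ENNReal.ofReal (l A)) (by simp [hempty]) ?_, ?_, ?_⟩
  · intro A hA hd
    rw [← (hsum A hA hd).tsum_eq,
      ENNReal.ofReal_tsum_of_nonneg (fun i => hnn _ (hA i)) (hsum A hA hd).summable]
  · constructor
    rw [Measure.ofMeasurable_apply _ MeasurableSet.univ]
    exact ENNReal.ofReal_lt_top
  · intro n A hA
    rw [measureReal_def (Measure.ofMeasurable _ _ _), Measure.ofMeasurable_apply _ hA,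
      ENNReal.toReal_ofReal (hnn A hA)]
    exact hclose n A hA

/-- Integrating a jointly measurable function against a measurable family of finite measures
gives a measurable function. -/
theorem measurable_lintegral_of_finite {v : ℝ → Measure X} (hv : Measurable v)
    [∀ s, IsFiniteMeasure (v s)] {Y : Type*} [MeasurableSpace Y] {g : Y → ℝ} (hg : Measurable g)
    {f : Y → X → ℝ≥0∞} (hf : Measurable (Function.uncurry f)) :
    Measurable fun y => ∫⁻ x, f y x ∂(v (g y)) := by
  have hmass : Measurable fun s => v s univ := Measure.measurable_coe MeasurableSet.univ |>.comp hv
  let κ : Kernel Y X :=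
    { toFun := fun y => (v (g y) univ)⁻¹ • v (g y)
      measurable' := by
        refine Measure.measurable_of_measurable_coe _ fun A hA => ?_
        simp only [Measure.smul_apply, smul_eq_mul]
        exact ((hmass.comp hg).inv).mul ((Measure.measurable_coe hA).comp (hv.comp hg)) }
  have hκ : ∀ y, κ y = (v (g y) univ)⁻¹ • v (g y) := fun y => rfl
  have : IsFiniteKernel κ := ⟨1, ENNReal.one_lt_top, fun y => by
    rw [hκ, Measure.smul_apply, smul_eq_mul]; exact ENNReal.inv_mul_le_one _⟩
  have : (fun y => ∫⁻ x, f y x ∂(v (g y))) = fun y => v (g y) univ * ∫⁻ x, f y x ∂(κ y) := by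
    funext y
    rw [hκ, lintegral_smul_measure, smul_eq_mul, ← mul_assoc]
    rcases eq_or_ne (v (g y) univ) 0 with h0 | h0
    · simp [Measure.measure_univ_eq_zero.1 h0]
    · rw [ENNReal.mul_inv_cancel h0 (measure_ne_top _ _), one_mul]
  rw [this]
  exact (hmass.comp hg).mul hf.lintegral_kernel_prod_right

/-- Integral of a bounded function against a mixture of measures of bounded mass. -/
theorem integral_bind_of_abs_le {m : Measure ℝ} [IsFiniteMeasure m] {η : ℝ → Measure X}
    (hη : Measurable η) [∀ s, IsFiniteMeasure (η s)] {b : ℝ≥0∞} (hb : b < ∞)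
    (hηb : ∀ᵐ s ∂m, η s univ ≤ b)
    {φ : X → ℝ} (hφ : Measurable φ) {c : ℝ} (hc : ∀ x, |φ x| ≤ c) :
    IsFiniteMeasure (m.bind η) ∧ ∫ x, φ x ∂(m.bind η) = ∫ s, ∫ x, φ x ∂(η s) ∂m := by
  have hfin : IsFiniteMeasure (m.bind η) := by
    constructor
    rw [Measure.bind_apply MeasurableSet.univ hη.aemeasurable]
    calc ∫⁻ s, η s univ ∂m ≤ ∫⁻ _, b ∂m := lintegral_mono_ae hηb
      _ = b * m univ := lintegral_const b
      _ < ∞ := ENNReal.mul_lt_top hb (measure_lt_top _ _)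
  refine ⟨hfin, ?_⟩
  let κ : Kernel ℝ X := ⟨η, hη⟩
  have := Kernel.integral_comp (κ := Kernel.const Unit m) (η := κ) (a := ()) (f := φ)
    (by rw [Kernel.comp_apply]; exact integrable_of_abs_le (p := m.bind η) hφ hc)
  rw [Kernel.comp_apply] at this
  exact this

end General

section Picard

variable {X : Type*} [MeasurableSpace X]

/-- The Picard operator of the measure-valued evolution equation `v' = H s v`. -/
noncomputable def picardStep (H : ℝ → Measure X → Measure X) (μ0 : Measure X)
    (v : ℝ → Measure X) (t : ℝ) : Measure X :=
  μ0 + (volume.restrict (Ioc 0 t)).bind fun s => H s (v s)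

/-- A measure-valued vector field preserving positivity, with a mass bound `M` and Lipschitz with
respect to uniform convergence on measurable sets. -/
structure IsPositiveField (H : ℝ → Measure X → Measure X) (M M' : ℝ → ℝ) : Prop where
  hasDerivAt : ∀ s, HasDerivAt M (M' s) s
  continuous_deriv : Continuous M'
  deriv_nonneg : ∀ s, 0 ≤ s → 0 ≤ M' s
  finite : ∀ s v, IsFiniteMeasure v → IsFiniteMeasure (H s v)
  mass : ∀ s v, IsFiniteMeasure v → 0 ≤ s → v.real univ ≤ M s → (H s v).real univ ≤ M' s
  measurable : ∀ v : ℝ → Measure X, Measurable v → (∀ s, IsFiniteMeasure (v s)) →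
    Measurable fun s => H s (v s)
  lipschitz : ∀ T, 0 ≤ T → ∃ L, 0 < L ∧ ∀ s ∈ Icc 0 T, ∀ v w : Measure X,
    IsFiniteMeasure v → IsFiniteMeasure w → v.real univ ≤ M s → w.real univ ≤ M s →
    ∀ d, SetwiseClose v w d → SetwiseClose (H s v) (H s w) (L * d)

/-- Measurable curves of finite measures whose mass is controlled by `M`. -/
structure IsAdmissible (M : ℝ → ℝ) (v : ℝ → Measure X) : Prop where
  measurable : Measurable v
  finite : ∀ s, IsFiniteMeasure (v s)
  mass : ∀ s, 0 ≤ s → (v s).real univ ≤ M s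

variable {H : ℝ → Measure X → Measure X} {M M' : ℝ → ℝ} {μ0 : Measure X}

theorem IsPositiveField.mass_bound (hH : IsPositiveField H M M') {v : ℝ → Measure X}
    (hv : IsAdmissible M v) {s : ℝ} (hs : 0 ≤ s) {A : Set X} :
    (H s (v s)).real A ≤ M' s := by
  have := hv.finite s
  have := hH.finite s (v s) this
  exact (measureReal_mono (subset_univ A)).trans (hH.mass s (v s) (hv.finite s) hs (hv.mass s hs))

theorem IsPositiveField.exists_mass_le (hH : IsPositiveField H M M') (t : ℝ) :
    ∃ b : ℝ≥0∞, b < ∞ ∧ ∀ v, IsAdmissible M v →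
      ∀ᵐ s ∂(volume.restrict (Ioc 0 t)), H s (v s) univ ≤ b := by
  obtain ⟨C, hC⟩ := isCompact_Icc (a := (0 : ℝ)) (b := t) |>.exists_bound_of_continuousOn
    hH.continuous_deriv.continuousOn
  refine ⟨ENNReal.ofReal C, ENNReal.ofReal_lt_top, fun v hv =>
    ae_restrict_of_forall_mem measurableSet_Ioc fun s hs => ?_⟩
  have := hH.finite s (v s) (hv.finite s)
  rw [← ofReal_measureReal]
  exact ENNReal.ofReal_le_ofReal ((hH.mass_bound hv hs.1.le).trans
    ((le_abs_self _).trans (hC s (Ioc_subset_Icc_self hs))))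

theorem IsPositiveField.integrableOn (hH : IsPositiveField H M M') {v : ℝ → Measure X}
    (hv : IsAdmissible M v) {A : Set X} (hA : MeasurableSet A) (t : ℝ) :
    IntegrableOn (fun s => (H s (v s)).real A) (Ioc 0 t) := by
  refine Integrable.mono' (g := M')
    ((hH.continuous_deriv.integrableOn_Icc (a := 0) (b := t)).mono_set Ioc_subset_Icc_self)
    ?_ (ae_restrict_of_forall_mem measurableSet_Ioc fun s hs => ?_)
  · exact ((Measure.measurable_coe hA).comp
      (hH.measurable v hv.measurable hv.finite)).ennreal_toReal.aestronglyMeasurable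
  · rw [Real.norm_of_nonneg measureReal_nonneg]
    exact hH.mass_bound hv hs.1.le

theorem IsPositiveField.isFiniteMeasure_bind (hH : IsPositiveField H M M') {v : ℝ → Measure X}
    (hv : IsAdmissible M v) (t : ℝ) :
    IsFiniteMeasure ((volume.restrict (Ioc 0 t)).bind fun s => H s (v s)) := by
  obtain ⟨b, hb, hbound⟩ := hH.exists_mass_le t
  have : ∀ s, IsFiniteMeasure (H s (v s)) := fun s => hH.finite s _ (hv.finite s)
  exact (integral_bind_of_abs_le (hH.measurable v hv.measurable hv.finite) hb (hbound v hv)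
    (φ := 0) measurable_zero (c := 0) (by simp)).1

theorem IsPositiveField.real_picardStep (hH : IsPositiveField H M M') [IsFiniteMeasure μ0]
    {v : ℝ → Measure X} (hv : IsAdmissible M v) {A : Set X} (hA : MeasurableSet A) (t : ℝ) :
    (picardStep H μ0 v t).real A = μ0.real A + ∫ s in Ioc 0 t, (H s (v s)).real A := by
  have := hH.isFiniteMeasure_bind hv t
  rw [picardStep, measureReal_add_apply]
  congr 1
  have hm := hH.measurable v hv.measurable hv.finite
  rw [measureReal_def, Measure.bind_apply hA hm.aemeasurable]
  symm
  exact integral_toReal ((Measure.measurable_coe hA).comp hm).aemeasurable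
    (ae_of_all _ fun s => have := hH.finite s _ (hv.finite s); measure_lt_top _ _)

theorem IsPositiveField.isAdmissible_picardStep (hH : IsPositiveField H M M')
    [IsFiniteMeasure μ0] (h0 : μ0.real univ = M 0) {v : ℝ → Measure X} (hv : IsAdmissible M v) :
    IsAdmissible M (picardStep H μ0 v) := by
  have hm := hH.measurable v hv.measurable hv.finite
  refine ⟨Measure.measurable_of_measurable_coe _ fun A hA => ?_, fun t => ?_, fun t ht => ?_⟩
  · have : (fun t => picardStep H μ0 v t A) = fun t => μ0 A +
        ∫⁻ s, (if 0 < s ∧ s ≤ t then H s (v s) A else 0) := by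
      funext t
      rw [picardStep, Measure.add_apply, Measure.bind_apply hA hm.aemeasurable,
        ← lintegral_indicator measurableSet_Ioc]
      simp only [indicator_apply, mem_Ioc]
    rw [this]
    refine measurable_const.add (Measurable.lintegral_prod_right' (f := fun p : ℝ × ℝ =>
      if 0 < p.2 ∧ p.2 ≤ p.1 then H p.2 (v p.2) A else 0) ?_)
    refine Measurable.ite ?_ (((Measure.measurable_coe hA).comp hm).comp measurable_snd)
      measurable_const
    exact (measurableSet_lt measurable_const measurable_snd).inter
      (measurableSet_le measurable_snd measurable_fst)
  · have := hH.isFiniteMeasure_bind hv t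
    rw [picardStep]
    infer_instance
  · rw [hH.real_picardStep hv MeasurableSet.univ, h0]
    have h1 : ∫ s in Ioc 0 t, (H s (v s)).real univ ≤ ∫ s in Ioc 0 t, M' s :=
      setIntegral_mono_on (hH.integrableOn hv MeasurableSet.univ t)
        ((hH.continuous_deriv.integrableOn_Icc).mono_set Ioc_subset_Icc_self) measurableSet_Ioc
        fun s hs => hH.mass_bound hv hs.1.le
    have h2 : ∫ s in Ioc 0 t, M' s = M t - M 0 := by
      rw [← intervalIntegral.integral_of_le ht]
      exact intervalIntegral.integral_eq_sub_of_hasDerivAt (fun s _ => hH.hasDerivAt s)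
        (hH.continuous_deriv.intervalIntegrable _ _)
    linarith

theorem IsPositiveField.setwiseClose_picardStep (hH : IsPositiveField H M M')
    [IsFiniteMeasure μ0] {v w : ℝ → Measure X} (hv : IsAdmissible M v) (hw : IsAdmissible M w)
    {T L B : ℝ} (hB : 0 ≤ B)
    (hLip : ∀ s ∈ Icc 0 T, ∀ v w : Measure X, IsFiniteMeasure v → IsFiniteMeasure w →
      v.real univ ≤ M s → w.real univ ≤ M s →
      ∀ d, SetwiseClose v w d → SetwiseClose (H s v) (H s w) (L * d))
    (hvw : ∀ s ∈ Icc 0 T, SetwiseClose (v s) (w s) (B * Real.exp (2 * L * s)))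
    {t : ℝ} (ht : t ∈ Icc 0 T) :
    SetwiseClose (picardStep H μ0 v t) (picardStep H μ0 w t) (B / 2 * Real.exp (2 * L * t)) := by
  intro A hA
  rw [hH.real_picardStep hv hA, hH.real_picardStep hw hA, add_sub_add_left_eq_sub,
    ← integral_sub (hH.integrableOn hv hA t) (hH.integrableOn hw hA t)]
  have hcont : Continuous fun s : ℝ => L * (B * Real.exp (2 * L * s)) := by fun_prop
  have h1 : ‖∫ s in Ioc 0 t, ((H s (v s)).real A - (H s (w s)).real A)‖
      ≤ ∫ s in Ioc 0 t, L * (B * Real.exp (2 * L * s)) := by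
    refine norm_integral_le_of_norm_le
      (hcont.integrableOn_Icc.mono_set Ioc_subset_Icc_self)
      (ae_restrict_of_forall_mem measurableSet_Ioc fun s hs => ?_)
    have hs' : s ∈ Icc 0 T := ⟨hs.1.le, hs.2.trans ht.2⟩
    exact hLip s hs' _ _ (hv.finite s) (hw.finite s) (hv.mass s hs.1.le) (hw.mass s hs.1.le) _
      (hvw s hs') A hA
  have h2 : ∫ s in Ioc 0 t, L * (B * Real.exp (2 * L * s))
      = B / 2 * Real.exp (2 * L * t) - B / 2 * Real.exp (2 * L * 0) := by
    rw [← intervalIntegral.integral_of_le ht.1]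
    refine intervalIntegral.integral_eq_sub_of_hasDerivAt
      (f := fun s => B / 2 * Real.exp (2 * L * s)) (fun s _ => ?_)
      (hcont.intervalIntegrable _ _)
    have := ((((hasDerivAt_id s).const_mul (2 * L)).exp).const_mul (B / 2))
    refine this.congr_deriv ?_
    simp only [id]
    ring
  rw [Real.norm_eq_abs, h2] at h1
  refine h1.trans (sub_le_self _ (by positivity))

theorem IsPositiveField.exists_fixedPoint (hH : IsPositiveField H M M') [IsFiniteMeasure μ0]
    (h0 : μ0.real univ = M 0) :
    ∃ v : ℝ → Measure X, IsAdmissible M v ∧ ∀ t, 0 ≤ t → v t = picardStep H μ0 v t := by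
  have hmono : ∀ t, 0 ≤ t → M 0 ≤ M t := by
    intro t ht
    have h1 : ∫ s in (0)..t, M' s = M t - M 0 :=
      intervalIntegral.integral_eq_sub_of_hasDerivAt (fun s _ => hH.hasDerivAt s)
        (hH.continuous_deriv.intervalIntegrable _ _)
    have h2 : 0 ≤ ∫ s in (0)..t, M' s :=
      intervalIntegral.integral_nonneg ht fun s hs => hH.deriv_nonneg s hs.1
    linarith
  let V : ℕ → ℝ → Measure X := fun n => (picardStep H μ0)^[n] fun _ => μ0
  have hVsucc : ∀ n, V (n + 1) = picardStep H μ0 (V n) := fun n =>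
    Function.iterate_succ_apply' _ _ _
  have hV : ∀ n, IsAdmissible M (V n) := by
    intro n
    induction n with
    | zero =>
      exact ⟨measurable_const, fun _ => inferInstanceAs (IsFiniteMeasure μ0),
        fun s hs => h0.trans_le (hmono s hs)⟩
    | succ n ih => rw [hVsucc]; exact hH.isAdmissible_picardStep h0 ih
  have hVfin : ∀ n t, IsFiniteMeasure (V n t) := fun n t => (hV n).finite t
  have hclose : ∀ T, 0 ≤ T → ∃ L B, 0 < L ∧ 0 ≤ B ∧
      (∀ s ∈ Icc 0 T, ∀ v w : Measure X, IsFiniteMeasure v → IsFiniteMeasure w →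
        v.real univ ≤ M s → w.real univ ≤ M s →
        ∀ d, SetwiseClose v w d → SetwiseClose (H s v) (H s w) (L * d)) ∧
      ∀ n, ∀ t ∈ Icc 0 T,
        SetwiseClose (V n t) (V (n + 1) t) (B / 2 ^ n * Real.exp (2 * L * t)) := by
    intro T hT
    obtain ⟨L, hL, hLip⟩ := hH.lipschitz T hT
    obtain ⟨B, hB⟩ := isCompact_Icc (a := (0 : ℝ)) (b := T) |>.exists_bound_of_continuousOn
      (f := M) fun s _ => (hH.hasDerivAt s).continuousAt.continuousWithinAt
    have hB0 : 0 ≤ B := (norm_nonneg _).trans (hB 0 ⟨le_rfl, hT⟩)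
    refine ⟨L, B, hL, hB0, hLip, fun n => ?_⟩
    induction n with
    | zero =>
      intro t ht A hA
      have hb : ∀ n, (V n t).real A ≤ B := fun n => (measureReal_mono (subset_univ A)).trans
        (((hV n).mass t ht.1).trans ((le_abs_self _).trans (hB t ht)))
      have h1 : |(V 0 t).real A - (V (0 + 1) t).real A| ≤ B := by
        rw [abs_le]
        have h2 := hb 0
        have h3 := hb (0 + 1)
        have h4 : 0 ≤ (V 0 t).real A := measureReal_nonneg
        have h5 : 0 ≤ (V (0 + 1) t).real A := measureReal_nonneg
        constructor <;> linarith
      have h6 : 1 ≤ Real.exp (2 * L * t) :=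
        Real.one_le_exp (mul_nonneg (by positivity) ht.1)
      simp only [pow_zero, div_one]
      nlinarith
    | succ n ih =>
      intro t ht
      have := hH.setwiseClose_picardStep (μ0 := μ0) (hV n) (hV (n + 1))
        (by positivity : 0 ≤ B / 2 ^ n) hLip ih ht
      rw [← hVsucc, ← hVsucc] at this
      convert this using 2
      rw [pow_succ, div_div]
  have hgeom : ∀ T, ∃ C, 0 ≤ C ∧ ∀ t ≤ T, ∀ n,
      SetwiseClose (V n t) (V (n + 1) t) (C / 2 / 2 ^ n) := by
    intro T
    obtain ⟨L, B, hL, hB, -, hc⟩ := hclose (max T 0) (le_max_right _ _)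
    refine ⟨2 * (B * Real.exp (2 * L * max T 0)), by positivity, fun t ht n A hA => ?_⟩
    rcases le_or_gt 0 t with h | h
    · refine (hc n t ⟨h, ht.trans (le_max_left _ _)⟩ A hA).trans ?_
      rw [mul_div_cancel_left₀ _ (two_ne_zero), div_mul_eq_mul_div]
      gcongr
      exact ht.trans (le_max_left _ _)
    · have : ∀ n, V n t = μ0 := by
        intro n
        cases n with
        | zero => rfl
        | succ n => rw [hVsucc, picardStep, Ioc_eq_empty (by simpa using h.le)]; simp
      rw [this, this, sub_self, abs_zero]
      positivity
  have hex : ∀ t, ∃ w : Measure X, IsFiniteMeasure w ∧ ∀ A, MeasurableSet A →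
      Tendsto (fun n => (V n t).real A) atTop (𝓝 (w.real A)) := by
    intro t
    obtain ⟨C, hC, hc⟩ := hgeom t
    obtain ⟨w, hw, hcl⟩ := exists_measure_setwiseClose (fun n => V n t) C (hc t le_rfl)
    refine ⟨w, hw, fun A hA => ?_⟩
    rw [tendsto_iff_dist_tendsto_zero]
    refine squeeze_zero (fun _ => dist_nonneg) (fun n => hcl n A hA) ?_
    exact tendsto_const_nhds.div_atTop (tendsto_pow_atTop_atTop_of_one_lt one_lt_two)
  choose v hvfin hvlim using hex
  have hv : IsAdmissible M v := by
    refine ⟨Measure.measurable_of_measurable_coe _ fun A hA => ?_, hvfin, fun s hs =>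
      le_of_tendsto' (hvlim s _ MeasurableSet.univ) fun n => (hV n).mass s hs⟩
    refine measurable_of_tendsto_metrizable (f := fun n t => V n t A)
      (fun n => (Measure.measurable_coe hA).comp (hV n).measurable) ?_
    rw [tendsto_pi_nhds]
    intro t
    exact (ENNReal.tendsto_toReal_iff (fun n => measure_ne_top _ _) (measure_ne_top _ _)).1
      (hvlim t A hA)
  refine ⟨v, hv, fun t ht => ?_⟩
  obtain ⟨L, B, hL, hB, hLip, hc⟩ := hclose t ht
  obtain ⟨C, hC, hgc⟩ := hgeom t
  have hcv : ∀ n, ∀ s ∈ Icc 0 t, SetwiseClose (V n s) (v s) (C / 2 ^ n * Real.exp (2 * L * s)) := by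
    intro n s hs A hA
    refine (dist_le_of_le_geometric_two_of_tendsto (f := fun n => (V n s).real A)
      (fun n => hgc s hs.2 n A hA) (hvlim s A hA) n).trans ?_
    exact le_mul_of_one_le_right (by positivity)
      (Real.one_le_exp (mul_nonneg (by positivity) hs.1))
  have hstepfin := (hH.isAdmissible_picardStep h0 hv).finite t
  ext A hA
  rw [← ENNReal.toReal_eq_toReal_iff' (measure_ne_top _ _) (measure_ne_top _ _)]
  refine tendsto_nhds_unique ((hvlim t A hA).comp (tendsto_add_atTop_nat 1)) ?_
  rw [tendsto_iff_dist_tendsto_zero]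
  refine squeeze_zero (fun _ => dist_nonneg)
    (g := fun n : ℕ => C / 2 ^ n / 2 * Real.exp (2 * L * t)) (fun n => ?_) ?_
  · have := hH.setwiseClose_picardStep (μ0 := μ0) (hV n) hv (by positivity : 0 ≤ C / 2 ^ n)
      hLip (hcv n) ⟨ht, le_rfl⟩ A hA
    rw [← hVsucc] at this
    exact this
  · have h1 : Tendsto (fun n : ℕ => C / 2 ^ n) atTop (𝓝 0) :=
      tendsto_const_nhds.div_atTop (tendsto_pow_atTop_atTop_of_one_lt one_lt_two)
    simpa using (h1.div_const 2).mul_const (Real.exp (2 * L * t))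

end Picard

section QuadraticForm

variable {X : Type*} [MeasurableSpace X]

/-- The quadratic functional of a measure with bilinear part `A` and linear part `B`. -/
noncomputable def quadForm (A : X → X → ℝ) (B : X → ℝ) (w : Measure X) : ℝ :=
  ∫ x, ∫ y, A x y ∂w ∂w + ∫ x, B x ∂w

theorem measurable_integral_right {Y : Type*} [MeasurableSpace Y] {A : X → Y → ℝ}
    (hA : Measurable (Function.uncurry A)) (p : Measure Y) [IsFiniteMeasure p] :
    Measurable fun x => ∫ y, A x y ∂p :=
  (hA.stronglyMeasurable.integral_prod_right (ν := p)).measurable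

theorem abs_quadForm_sub_le {A : X → X → ℝ} {B : X → ℝ} (hA : Measurable (Function.uncurry A))
    (hB : Measurable B) {a b m d : ℝ} (ha0 : 0 ≤ a) (hb0 : 0 ≤ b)
    (ha : ∀ x y, |A x y| ≤ a) (hb : ∀ x, |B x| ≤ b)
    {p q : Measure X} [IsFiniteMeasure p] [IsFiniteMeasure q] (hp : p.real univ ≤ m)
    (hq : q.real univ ≤ m) (h : SetwiseClose p q d) :
    |quadForm A B p - quadForm A B q| ≤ (6 * a * m + 3 * b) * d := by
  have hm : 0 ≤ m := measureReal_nonneg.trans hp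
  have hd : 0 ≤ d := (abs_nonneg _).trans (h univ MeasurableSet.univ)
  have hbound : ∀ (r : Measure X) [IsFiniteMeasure r], r.real univ ≤ m →
      ∀ x, |∫ y, A x y ∂r| ≤ a * m := fun r _ hr x =>
    (abs_integral_le_of_abs_le (ha x)).trans (mul_le_mul_of_nonneg_left hr ha0)
  have h1 := h.abs_integral_sub_le (measurable_integral_right hA p) (mul_nonneg ha0 hm)
    (hbound p hp)
  have h2 : |∫ x, (∫ y, A x y ∂p - ∫ y, A x y ∂q) ∂q| ≤ 3 * a * d * m :=
    (abs_integral_le_of_abs_le fun x => h.abs_integral_sub_le (hA.of_uncurry_left) ha0 (ha x)).trans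
      (mul_le_mul_of_nonneg_left hq (by positivity))
  rw [integral_sub (integrable_of_abs_le (measurable_integral_right hA p) (hbound p hp))
    (integrable_of_abs_le (measurable_integral_right hA q) (hbound q hq))] at h2
  have h3 := h.abs_integral_sub_le hB hb0 hb
  rw [quadForm, quadForm]
  rw [abs_le] at h1 h2 h3 ⊢
  constructor <;> linarith

end QuadraticForm

section Generator

/-- The coagulation operator acting on test functions. -/
noncomputable def coagOp (K : ℝ → ℝ → ℝ) (φ : ℝ → ℝ) (x y : ℝ) : ℝ :=
  K x y * ((1 / 2) * φ (x + y) - φ x)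

/-- The fragmentation operator, with at most `k` fragments, acting on test functions. -/
noncomputable def fragOp (F : ℝ → ℝ) (β : Measure DislocationSpace) (k : ℕ) (φ : ℝ → ℝ)
    (x : ℝ) : ℝ :=
  F x * ∫ θ : DislocationSpace,
    ((∑ i ∈ Finset.range k, if 0 < θ.1 i * x then φ (θ.1 i * x) else 0) - φ x) ∂β

/-- The weak generator of the coagulation-fragmentation equation. -/
noncomputable def generator (K : ℝ → ℝ → ℝ) (F : ℝ → ℝ) (β : Measure DislocationSpace) (k : ℕ)
    (φ : ℝ → ℝ) (w : Measure ℝ) : ℝ :=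
  quadForm (coagOp K φ) (fragOp F β k φ) w

/-- Kernels which are nonnegative, measurable and bounded on the whole line. -/
structure IsBddKernel (K : ℝ → ℝ → ℝ) (F : ℝ → ℝ) (Kbar Fbar : ℝ) : Prop where
  measurable_coag : Measurable (Function.uncurry K)
  coag_nonneg : ∀ x y, 0 ≤ K x y
  coag_le : ∀ x y, K x y ≤ Kbar
  measurable_frag : Measurable F
  frag_nonneg : ∀ x, 0 ≤ F x
  frag_le : ∀ x, F x ≤ Fbar

theorem measurable_fragment (i : ℕ) :
    Measurable fun p : ℝ × DislocationSpace => p.2.1 i * p.1 :=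
  ((measurable_pi_apply i).comp (measurable_subtype_coe.comp measurable_snd)).mul measurable_fst

theorem measurable_ite_fragment {φ : ℝ → ℝ} (hφ : Measurable φ) (i : ℕ) :
    Measurable fun p : ℝ × DislocationSpace =>
      if 0 < p.2.1 i * p.1 then φ (p.2.1 i * p.1) else 0 :=
  Measurable.ite (measurableSet_lt measurable_const (measurable_fragment i))
    (hφ.comp (measurable_fragment i)) measurable_const

theorem measurable_sum_fragment {φ : ℝ → ℝ} (hφ : Measurable φ) (k : ℕ) :
    Measurable fun p : ℝ × DislocationSpace =>
      (∑ i ∈ Finset.range k, if 0 < p.2.1 i * p.1 then φ (p.2.1 i * p.1) else 0) - φ p.1 :=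
  (Finset.measurable_sum _ fun i _ => measurable_ite_fragment hφ i).sub (hφ.comp measurable_fst)

theorem abs_ite_le {P : Prop} [Decidable P] {a c : ℝ} (hc : 0 ≤ c) (h : |a| ≤ c) :
    |if P then a else 0| ≤ c := by
  split_ifs
  · exact h
  · simpa using hc

theorem abs_sum_fragment_le {φ : ℝ → ℝ} {c : ℝ} (hc0 : 0 ≤ c) (hc : ∀ x, |φ x| ≤ c) (k : ℕ)
    (x : ℝ) (θ : DislocationSpace) :
    |(∑ i ∈ Finset.range k, if 0 < θ.1 i * x then φ (θ.1 i * x) else 0) - φ x|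
      ≤ (k + 1) * c := by
  have h1 : |∑ i ∈ Finset.range k, if 0 < θ.1 i * x then φ (θ.1 i * x) else 0| ≤ k * c := by
    refine (Finset.abs_sum_le_sum_abs _ _).trans ?_
    refine (Finset.sum_le_card_nsmul _ _ c fun i _ => abs_ite_le hc0 (hc _)).trans ?_
    simp
  have h2 := hc x
  rw [abs_le] at h1 h2 ⊢
  constructor <;> linarith

variable {K : ℝ → ℝ → ℝ} {F : ℝ → ℝ} {Kbar Fbar : ℝ} {β : Measure DislocationSpace}
  {k : ℕ} {φ : ℝ → ℝ} {c : ℝ}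

theorem IsBddKernel.coag_bound_nonneg (hK : IsBddKernel K F Kbar Fbar) : 0 ≤ Kbar :=
  (hK.coag_nonneg 0 0).trans (hK.coag_le 0 0)

theorem IsBddKernel.frag_bound_nonneg (hK : IsBddKernel K F Kbar Fbar) : 0 ≤ Fbar :=
  (hK.frag_nonneg 0).trans (hK.frag_le 0)

/-- The density of particles remaining after subtracting the total reaction rate from `γ`. -/
noncomputable def survivalRate (K : ℝ → ℝ → ℝ) (F : ℝ → ℝ) (β : Measure DislocationSpace)
    (γ : ℝ) (w : Measure ℝ) (x : ℝ) : ℝ :=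
  γ - F x * β.real univ - (∫⁻ y, ENNReal.ofReal (K x y) ∂w).toReal

theorem IsBddKernel.integral_coag (hK : IsBddKernel K F Kbar Fbar) (w : Measure ℝ) (x : ℝ) :
    (∫⁻ y, ENNReal.ofReal (K x y) ∂w).toReal = ∫ y, K x y ∂w :=
  (integral_eq_lintegral_of_nonneg_ae (ae_of_all _ (hK.coag_nonneg x))
    hK.measurable_coag.of_uncurry_left.aestronglyMeasurable).symm

theorem IsBddKernel.measurable_survivalRate (hK : IsBddKernel K F Kbar Fbar) (γ : ℝ)
    (w : Measure ℝ) [IsFiniteMeasure w] : Measurable (survivalRate K F β γ w) :=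
  (measurable_const.sub (hK.measurable_frag.mul_const _)).sub
    (hK.measurable_coag.ennreal_ofReal.lintegral_prod_right').ennreal_toReal

theorem IsBddKernel.survivalRate_le (hK : IsBddKernel K F Kbar Fbar) (γ : ℝ)
    (w : Measure ℝ) (x : ℝ) : survivalRate K F β γ w x ≤ γ := by
  have h1 : 0 ≤ F x * β.real univ := mul_nonneg (hK.frag_nonneg x) measureReal_nonneg
  have h2 : 0 ≤ (∫⁻ y, ENNReal.ofReal (K x y) ∂w).toReal := ENNReal.toReal_nonneg
  rw [survivalRate]
  linarith

theorem IsBddKernel.survivalRate_nonneg (hK : IsBddKernel K F Kbar Fbar) {γ : ℝ}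
    {w : Measure ℝ} [IsFiniteMeasure w]
    (hγ : Fbar * β.real univ + Kbar * w.real univ ≤ γ) (x : ℝ) :
    0 ≤ survivalRate K F β γ w x := by
  have h1 : F x * β.real univ ≤ Fbar * β.real univ :=
    mul_le_mul_of_nonneg_right (hK.frag_le x) measureReal_nonneg
  have h2 : |∫ y, K x y ∂w| ≤ Kbar * w.real univ := abs_integral_le_of_abs_le fun y => by
    rw [abs_of_nonneg (hK.coag_nonneg x y)]; exact hK.coag_le x y
  rw [survivalRate, hK.integral_coag]
  linarith [(abs_le.1 h2).2]

theorem IsBddKernel.isFiniteMeasure_survival (hK : IsBddKernel K F Kbar Fbar) (γ : ℝ)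
    (w : Measure ℝ) [IsFiniteMeasure w] :
    IsFiniteMeasure (w.withDensity fun x => ENNReal.ofReal (survivalRate K F β γ w x)) := by
  constructor
  rw [withDensity_apply _ MeasurableSet.univ, Measure.restrict_univ]
  refine (lintegral_mono fun x => ENNReal.ofReal_le_ofReal (hK.survivalRate_le γ w x)).trans_lt ?_
  rw [lintegral_const]
  exact ENNReal.mul_lt_top ENNReal.ofReal_lt_top (measure_lt_top _ _)

variable [IsFiniteMeasure β]

theorem IsBddKernel.measurable_coagOp (hK : IsBddKernel K F Kbar Fbar) (hφ : Measurable φ) :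
    Measurable (Function.uncurry (coagOp K φ)) :=
  hK.measurable_coag.mul
    (((hφ.comp (measurable_fst.add measurable_snd)).const_mul _).sub (hφ.comp measurable_fst))

theorem IsBddKernel.measurable_fragOp (hK : IsBddKernel K F Kbar Fbar) (hφ : Measurable φ) :
    Measurable (fragOp F β k φ) :=
  hK.measurable_frag.mul (measurable_integral_right (measurable_sum_fragment hφ k) β)

theorem IsBddKernel.abs_coagOp_le (hK : IsBddKernel K F Kbar Fbar) (hc : ∀ x, |φ x| ≤ c)
    (x y : ℝ) : |coagOp K φ x y| ≤ Kbar * (2 * c) := by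
  rw [coagOp, abs_mul, abs_of_nonneg (hK.coag_nonneg x y)]
  refine mul_le_mul (hK.coag_le x y) ?_ (abs_nonneg _) hK.coag_bound_nonneg
  have h1 := hc (x + y)
  have h2 := hc x
  have h0 : 0 ≤ c := (abs_nonneg _).trans h2
  rw [abs_le] at h1 h2 ⊢
  constructor <;> linarith

theorem IsBddKernel.abs_fragOp_le (hK : IsBddKernel K F Kbar Fbar) (hc : ∀ x, |φ x| ≤ c)
    (x : ℝ) : |fragOp F β k φ x| ≤ Fbar * ((k + 1) * c * β.real univ) := by
  have h0 : 0 ≤ c := (abs_nonneg _).trans (hc x)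
  rw [fragOp, abs_mul, abs_of_nonneg (hK.frag_nonneg x)]
  exact mul_le_mul (hK.frag_le x) (abs_integral_le_of_abs_le (abs_sum_fragment_le h0 hc k x))
    (abs_nonneg _) hK.frag_bound_nonneg

/-- The Lipschitz constant of the generator on measures of mass at most `m`. -/
noncomputable def genLip (Kbar Fbar : ℝ) (β : Measure DislocationSpace) (k : ℕ) (m : ℝ) : ℝ :=
  6 * (Kbar * 2) * m + 3 * (Fbar * ((k + 1) * β.real univ))

theorem IsBddKernel.abs_generator_sub_le (hK : IsBddKernel K F Kbar Fbar) (hφ : Measurable φ)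
    (hc : ∀ x, |φ x| ≤ 1) {m d : ℝ}
    {p q : Measure ℝ} [IsFiniteMeasure p] [IsFiniteMeasure q] (hp : p.real univ ≤ m)
    (hq : q.real univ ≤ m) (h : SetwiseClose p q d) :
    |generator K F β k φ p - generator K F β k φ q| ≤ genLip Kbar Fbar β k m * d := by
  have h1 := hK.coag_bound_nonneg
  have h2 := hK.frag_bound_nonneg
  have := abs_quadForm_sub_le (hK.measurable_coagOp hφ) (hK.measurable_fragOp (β := β) (k := k) hφ)
    (by positivity) (by positivity) (hK.abs_coagOp_le hc) (hK.abs_fragOp_le hc) hp hq h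
  simpa [generator, genLip] using this

/-- Pushforward of a product measure weighted by a bounded density. -/
theorem integral_map_withDensity_prod {X Y : Type*} [MeasurableSpace X] [MeasurableSpace Y]
    {p : Measure X} {q : Measure Y} [IsFiniteMeasure p] [IsFiniteMeasure q] {f : X × Y → ℝ}
    (hf : Measurable f) (hf0 : ∀ z, 0 ≤ f z) {b : ℝ} (hfb : ∀ z, f z ≤ b) {g : X × Y → ℝ}
    (hg : Measurable g) (hφ : Measurable φ) (hc : ∀ x, |φ x| ≤ c) :
    IsFiniteMeasure (((p.prod q).withDensity fun z => ENNReal.ofReal (f z)).map g) ∧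
    ∫ z, φ z ∂(((p.prod q).withDensity fun z => ENNReal.ofReal (f z)).map g)
      = ∫ x, ∫ y, f (x, y) * φ (g (x, y)) ∂q ∂p := by
  have hfin : IsFiniteMeasure ((p.prod q).withDensity fun z => ENNReal.ofReal (f z)) := by
    refine isFiniteMeasure_withDensity_ofReal ?_
    exact (integrable_of_abs_le hf (c := b) fun z => by
      rw [abs_of_nonneg (hf0 z)]; exact hfb z).2
  refine ⟨inferInstance, ?_⟩
  rw [integral_map hg.aemeasurable hφ.aestronglyMeasurable,
    integral_withDensity_eq_integral_toReal_smul hf.ennreal_ofReal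
      (ae_of_all _ fun _ => ENNReal.ofReal_lt_top)]
  simp only [ENNReal.toReal_ofReal (hf0 _), smul_eq_mul]
  refine integral_prod (fun z => f z * φ (g z))
    (integrable_of_abs_le (c := b * c) (hf.mul (hφ.comp hg)) fun z => ?_)
  rw [abs_mul, abs_of_nonneg (hf0 z)]
  exact mul_le_mul (hfb z) (hc _) (abs_nonneg _) ((hf0 z).trans (hfb z))

/-- The measure representing `φ ↦ generator φ w + γ ∫ φ dw` when `γ` dominates the loss rate. -/
noncomputable def gainMeasure (K : ℝ → ℝ → ℝ) (F : ℝ → ℝ) (β : Measure DislocationSpace) (k : ℕ)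
    (γ : ℝ) (w : Measure ℝ) : Measure ℝ :=
  ((w.prod w).withDensity fun z => ENNReal.ofReal (K z.1 z.2 / 2)).map (fun z => z.1 + z.2)
  + ∑ i ∈ Finset.range k, ((w.prod β).withDensity fun z =>
      ENNReal.ofReal (if 0 < z.2.1 i * z.1 then F z.1 else 0)).map (fun z => z.2.1 i * z.1)
  + w.withDensity fun x => ENNReal.ofReal (survivalRate K F β γ w x)

theorem IsBddKernel.isFiniteMeasure_coagGain (hK : IsBddKernel K F Kbar Fbar) (w : Measure ℝ)
    [IsFiniteMeasure w] (hφ : Measurable φ) (hc : ∀ x, |φ x| ≤ c) :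
    IsFiniteMeasure (((w.prod w).withDensity fun z => ENNReal.ofReal (K z.1 z.2 / 2)).map
      (fun z => z.1 + z.2)) ∧
    ∫ z, φ z ∂(((w.prod w).withDensity fun z => ENNReal.ofReal (K z.1 z.2 / 2)).map
      (fun z => z.1 + z.2)) = ∫ x, ∫ y, K x y / 2 * φ (x + y) ∂w ∂w :=
  integral_map_withDensity_prod (b := Kbar) (hK.measurable_coag.div_const 2)
    (fun _ => div_nonneg (hK.coag_nonneg _ _) two_pos.le)
    (fun _ => (half_le_self (hK.coag_nonneg _ _)).trans (hK.coag_le _ _))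
    (measurable_fst.add measurable_snd) hφ hc

theorem IsBddKernel.isFiniteMeasure_fragGain (hK : IsBddKernel K F Kbar Fbar) (w : Measure ℝ)
    [IsFiniteMeasure w] (i : ℕ) (hφ : Measurable φ) (hc : ∀ x, |φ x| ≤ c) :
    IsFiniteMeasure (((w.prod β).withDensity fun z =>
      ENNReal.ofReal (if 0 < z.2.1 i * z.1 then F z.1 else 0)).map (fun z => z.2.1 i * z.1)) ∧
    ∫ z, φ z ∂(((w.prod β).withDensity fun z =>
      ENNReal.ofReal (if 0 < z.2.1 i * z.1 then F z.1 else 0)).map (fun z => z.2.1 i * z.1))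
      = ∫ x, ∫ θ, (if 0 < θ.1 i * x then F x else 0) * φ (θ.1 i * x) ∂β ∂w := by
  refine integral_map_withDensity_prod (b := Fbar)
    (f := fun z : ℝ × DislocationSpace => if 0 < z.2.1 i * z.1 then F z.1 else 0)
    (Measurable.ite (measurableSet_lt measurable_const (measurable_fragment i))
      (hK.measurable_frag.comp measurable_fst) measurable_const)
    (fun z => ?_) (fun z => ?_) (measurable_fragment i) hφ hc
  · split_ifs
    exacts [hK.frag_nonneg _, le_rfl]
  · split_ifs
    exacts [hK.frag_le _, hK.frag_bound_nonneg]

theorem IsBddKernel.isFiniteMeasure_gainMeasure (hK : IsBddKernel K F Kbar Fbar) (γ : ℝ)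
    (w : Measure ℝ) [IsFiniteMeasure w] : IsFiniteMeasure (gainMeasure K F β k γ w) := by
  have h1 := (hK.isFiniteMeasure_coagGain w (φ := 0) measurable_zero (c := 0) (by simp)).1
  have h2 := fun i =>
    (hK.isFiniteMeasure_fragGain (β := β) w i (φ := 0) measurable_zero (c := 0) (by simp)).1
  have h3 := hK.isFiniteMeasure_survival (β := β) γ w
  rw [gainMeasure]
  infer_instance

theorem IsBddKernel.integral_gainMeasure (hK : IsBddKernel K F Kbar Fbar) {γ : ℝ}
    {w : Measure ℝ} [IsFiniteMeasure w] (hγ : Fbar * β.real univ + Kbar * w.real univ ≤ γ)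
    (hφ : Measurable φ) (hc : ∀ x, |φ x| ≤ c) :
    ∫ x, φ x ∂(gainMeasure K F β k γ w) = generator K F β k φ w + γ * ∫ x, φ x ∂w := by
  obtain ⟨h1, h1'⟩ := hK.isFiniteMeasure_coagGain w hφ hc
  have h2 := fun i => (hK.isFiniteMeasure_fragGain (β := β) w i hφ hc).1
  have h2' := fun i => (hK.isFiniteMeasure_fragGain (β := β) w i hφ hc).2
  have h3 := hK.isFiniteMeasure_survival (β := β) γ w
  have h3' : ∫ x, φ x ∂(w.withDensity fun x => ENNReal.ofReal (survivalRate K F β γ w x))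
      = ∫ x, survivalRate K F β γ w x * φ x ∂w := by
    rw [integral_withDensity_eq_integral_toReal_smul
      (hK.measurable_survivalRate γ w).ennreal_ofReal (ae_of_all _ fun _ => ENNReal.ofReal_lt_top)]
    simp only [ENNReal.toReal_ofReal (hK.survivalRate_nonneg hγ _), smul_eq_mul]
  have hint : ∀ (m : Measure ℝ) [IsFiniteMeasure m], Integrable φ m := fun m _ =>
    integrable_of_abs_le hφ hc
  rw [gainMeasure, integral_add_measure (hint _) (hint _), integral_add_measure (hint _) (hint _),
    integral_finsetSum_measure fun i _ => hint _, h1', h3']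
  simp only [h2']
  have hsurv : ∀ x, survivalRate K F β γ w x * φ x
      = γ * φ x - F x * β.real univ * φ x - (∫ y, K x y ∂w) * φ x := by
    intro x
    rw [survivalRate, hK.integral_coag]
    ring
  have hKw : ∀ x, |∫ y, K x y ∂w| ≤ Kbar * w.real univ := fun x =>
    abs_integral_le_of_abs_le fun y => by
      rw [abs_of_nonneg (hK.coag_nonneg x y)]; exact hK.coag_le x y
  have hi1 : Integrable (fun x => γ * φ x) w := (hint w).const_mul γ
  have hFb : ∀ x, |F x| ≤ Fbar := fun x => by
    rw [abs_of_nonneg (hK.frag_nonneg x)]; exact hK.frag_le x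
  have hi2 : Integrable (fun x => F x * β.real univ * φ x) w := by
    refine integrable_of_abs_le (c := Fbar * β.real univ * c)
      ((hK.measurable_frag.mul_const _).mul hφ) fun x => ?_
    rw [abs_mul, abs_mul, abs_of_nonneg (measureReal_nonneg (μ := β))]
    have := hFb x
    have := hK.frag_bound_nonneg
    gcongr
    exact hc x
  have hi3 : Integrable (fun x => (∫ y, K x y ∂w) * φ x) w := by
    refine integrable_of_abs_le (c := Kbar * w.real univ * c)
      ((measurable_integral_right hK.measurable_coag w).mul hφ) fun x => ?_
    rw [abs_mul]
    have := hK.coag_bound_nonneg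
    gcongr
    exacts [hKw x, hc x]
  have hi4 : Integrable (fun x => ∫ y, K x y / 2 * φ (x + y) ∂w) w := by
    refine integrable_of_abs_le (c := Kbar * c * w.real univ)
      (measurable_integral_right (A := fun x y => K x y / 2 * φ (x + y))
        ((hK.measurable_coag.div_const 2).mul (hφ.comp (measurable_fst.add measurable_snd))) w)
      fun x => abs_integral_le_of_abs_le fun y => ?_
    rw [abs_mul, abs_of_nonneg (div_nonneg (hK.coag_nonneg x y) two_pos.le)]
    exact mul_le_mul ((half_le_self (hK.coag_nonneg _ _)).trans (hK.coag_le _ _)) (hc _)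
      (abs_nonneg _) hK.coag_bound_nonneg
  have hmi : ∀ i, Measurable (Function.uncurry fun (x : ℝ) (θ : DislocationSpace) =>
      (if 0 < θ.1 i * x then F x else 0) * φ (θ.1 i * x)) := fun i =>
    (Measurable.ite (measurableSet_lt measurable_const (measurable_fragment i))
      (hK.measurable_frag.comp measurable_fst) measurable_const).mul
      (hφ.comp (measurable_fragment i))
  have hbi : ∀ i x (θ : DislocationSpace),
      |(if 0 < θ.1 i * x then F x else 0) * φ (θ.1 i * x)| ≤ Fbar * c := fun i x θ => by
    rw [abs_mul]
    exact mul_le_mul (abs_ite_le hK.frag_bound_nonneg (hFb x)) (hc _) (abs_nonneg _)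
      hK.frag_bound_nonneg
  have hi5 : ∀ i, Integrable (fun x => ∫ θ : DislocationSpace,
      (if 0 < θ.1 i * x then F x else 0) * φ (θ.1 i * x) ∂β) w := fun i =>
    integrable_of_abs_le (measurable_integral_right (hmi i) β)
      fun x => abs_integral_le_of_abs_le (hbi i x)
  have hcoag : ∫ x, ∫ y, coagOp K φ x y ∂w ∂w
      = ∫ x, ∫ y, K x y / 2 * φ (x + y) ∂w ∂w - ∫ x, (∫ y, K x y ∂w) * φ x ∂w := by
    rw [← integral_sub hi4 hi3]
    refine integral_congr_ae (ae_of_all _ fun x => ?_)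
    simp only
    rw [← integral_mul_const, ← integral_sub]
    · refine integral_congr_ae (ae_of_all _ fun y => ?_)
      simp only [coagOp]
      ring
    · refine integrable_of_abs_le (c := Kbar * c)
        ((hK.measurable_coag.of_uncurry_left.div_const 2).mul
          (hφ.comp (measurable_const.add measurable_id))) fun y => ?_
      rw [abs_mul, abs_of_nonneg (div_nonneg (hK.coag_nonneg x y) two_pos.le)]
      exact mul_le_mul ((half_le_self (hK.coag_nonneg _ _)).trans (hK.coag_le _ _)) (hc _)
        (abs_nonneg _) hK.coag_bound_nonneg
    · refine Integrable.mul_const (integrable_of_abs_le (c := Kbar)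
        hK.measurable_coag.of_uncurry_left fun y => ?_) _
      rw [abs_of_nonneg (hK.coag_nonneg x y)]
      exact hK.coag_le x y
  have hfrag : ∫ x, fragOp F β k φ x ∂w
      = ∑ i ∈ Finset.range k, ∫ x, ∫ θ : DislocationSpace,
          (if 0 < θ.1 i * x then F x else 0) * φ (θ.1 i * x) ∂β ∂w
        - ∫ x, F x * β.real univ * φ x ∂w := by
    rw [← integral_finsetSum _ fun i _ => hi5 i,
      ← integral_sub (integrable_finsetSum _ fun i _ => hi5 i) hi2]
    refine integral_congr_ae (ae_of_all _ fun x => ?_)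
    have hii : ∀ i, Integrable (fun θ : DislocationSpace =>
        (if 0 < θ.1 i * x then F x else 0) * φ (θ.1 i * x)) β := fun i =>
      integrable_of_abs_le (hmi i).of_uncurry_left (hbi i x)
    simp only [fragOp]
    rw [← integral_finsetSum _ fun i _ => hii i, ← integral_const_mul]
    have : F x * β.real univ * φ x = ∫ _ : DislocationSpace, F x * φ x ∂β := by
      rw [integral_const, smul_eq_mul]
      ring
    rw [this, ← integral_sub (integrable_finsetSum _ fun i _ => hii i) (integrable_const _)]
    refine integral_congr_ae (ae_of_all _ fun θ => ?_)
    simp only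
    rw [mul_sub, Finset.mul_sum]
    congr 1
    refine Finset.sum_congr rfl fun i _ => ?_
    split_ifs <;> simp
  simp only [hsurv]
  have hi12 : Integrable (fun x => γ * φ x - F x * β.real univ * φ x) w := hi1.sub hi2
  rw [integral_sub hi12 hi3, integral_sub hi1 hi2, integral_const_mul, generator,
    quadForm, hcoag, hfrag]
  ring

end Generator

section Field

variable {K : ℝ → ℝ → ℝ} {F : ℝ → ℝ} {Kbar Fbar : ℝ} {β : Measure DislocationSpace}
  {k : ℕ} {γ : ℝ → ℝ}

theorem map_withDensity_prod_apply {X Y Z : Type*} [MeasurableSpace X] [MeasurableSpace Y]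
    [MeasurableSpace Z] {p : Measure X} {q : Measure Y} [SFinite p] [SFinite q]
    {f : X × Y → ℝ≥0∞} (hf : Measurable f) {g : X × Y → Z} (hg : Measurable g) {A : Set Z}
    (hA : MeasurableSet A) :
    (((p.prod q).withDensity f).map g) A
      = ∫⁻ x, ∫⁻ y, (g ⁻¹' A).indicator f (x, y) ∂q ∂p := by
  rw [Measure.map_apply hg hA, withDensity_apply _ (hg hA), ← lintegral_indicator (hg hA),
    lintegral_prod _ (hf.indicator (hg hA)).aemeasurable]

theorem IsBddKernel.measurable_gainMeasure [IsFiniteMeasure β] (hK : IsBddKernel K F Kbar Fbar)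
    (hγ : Measurable γ) {w : ℝ → Measure ℝ} (hw : Measurable w) [∀ s, IsFiniteMeasure (w s)] :
    Measurable fun s => gainMeasure K F β k (γ s) (w s) := by
  refine Measure.measurable_of_measurable_coe _ fun A hA => ?_
  simp only [gainMeasure, Measure.add_apply, Measure.finsetSum_apply]
  refine Measurable.add (Measurable.add ?_ (Finset.measurable_sum _ fun i _ => ?_)) ?_
  · have hf : Measurable fun z : ℝ × ℝ => ENNReal.ofReal (K z.1 z.2 / 2) :=
      (hK.measurable_coag.div_const 2).ennreal_ofReal
    have hg : Measurable fun z : ℝ × ℝ => z.1 + z.2 := measurable_fst.add measurable_snd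
    simp only [map_withDensity_prod_apply hf hg hA]
    refine measurable_lintegral_of_finite hw measurable_id
      (f := fun s x => ∫⁻ y, _ ∂(w s)) ?_
    exact measurable_lintegral_of_finite hw (Y := ℝ × ℝ) measurable_fst
      (f := fun p y => ((fun z : ℝ × ℝ => z.1 + z.2) ⁻¹' A).indicator
        (fun z : ℝ × ℝ => ENNReal.ofReal (K z.1 z.2 / 2)) (p.2, y))
      ((hf.indicator (hg hA)).comp ((measurable_snd.comp measurable_fst).prodMk measurable_snd))
  · have hf : Measurable fun z : ℝ × DislocationSpace =>
        ENNReal.ofReal (if 0 < z.2.1 i * z.1 then F z.1 else 0) :=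
      (Measurable.ite (measurableSet_lt measurable_const (measurable_fragment i))
        (hK.measurable_frag.comp measurable_fst) measurable_const).ennreal_ofReal
    simp only [map_withDensity_prod_apply hf (measurable_fragment i) hA]
    exact (Measure.measurable_lintegral
      (hf.indicator (measurable_fragment i hA)).lintegral_prod_right').comp hw
  · simp only [withDensity_apply _ hA, ← lintegral_indicator hA]
    refine measurable_lintegral_of_finite hw measurable_id ?_
    have hmass : Measurable fun p : ℝ × ℝ => ∫⁻ y, ENNReal.ofReal (K p.2 y) ∂(w p.1) :=
      measurable_lintegral_of_finite hw measurable_fst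
        (f := fun (p : ℝ × ℝ) y => ENNReal.ofReal (K p.2 y))
        (hK.measurable_coag.comp
          ((measurable_snd.comp measurable_fst).prodMk measurable_snd)).ennreal_ofReal
    exact (((hγ.comp measurable_fst).sub
      ((hK.measurable_frag.comp measurable_snd).mul_const _)).sub
        hmass.ennreal_toReal).ennreal_ofReal.indicator (measurable_snd hA)

theorem IsBddKernel.fragOp_one_le [IsFiniteMeasure β] (hK : IsBddKernel K F Kbar Fbar)
    (hk : 1 ≤ k) (x : ℝ) :
    fragOp F β k (fun _ => 1) x ≤ Fbar * ((k : ℝ) - 1) * β.real univ := by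
  have hk' : (0 : ℝ) ≤ (k : ℝ) - 1 := by
    rw [sub_nonneg]
    exact_mod_cast hk
  have h1 : ∫ θ : DislocationSpace,
      ((∑ i ∈ Finset.range k, if 0 < θ.1 i * x then (1 : ℝ) else 0) - 1) ∂β
      ≤ ∫ _ : DislocationSpace, ((k : ℝ) - 1) ∂β := by
    refine integral_mono (integrable_of_abs_le
      ((measurable_sum_fragment (φ := fun _ => 1) measurable_const k).comp measurable_prodMk_left)
      (abs_sum_fragment_le (c := 1) (φ := fun _ => 1) zero_le_one (by simp) k x))
      (integrable_const _) fun θ => ?_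
    have : ∑ i ∈ Finset.range k, (if 0 < θ.1 i * x then (1 : ℝ) else 0)
        ≤ ∑ _i ∈ Finset.range k, (1 : ℝ) := Finset.sum_le_sum fun i _ => by
      split_ifs <;> simp
    simpa using this
  rw [integral_const, smul_eq_mul] at h1
  calc fragOp F β k (fun _ => 1) x ≤ F x * (β.real univ * ((k : ℝ) - 1)) :=
        mul_le_mul_of_nonneg_left h1 (hK.frag_nonneg x)
    _ ≤ Fbar * (β.real univ * ((k : ℝ) - 1)) :=
        mul_le_mul_of_nonneg_right (hK.frag_le x) (mul_nonneg measureReal_nonneg hk')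
    _ = Fbar * ((k : ℝ) - 1) * β.real univ := by ring

theorem IsBddKernel.generator_one_le [IsFiniteMeasure β] (hK : IsBddKernel K F Kbar Fbar)
    (hk : 1 ≤ k) (w : Measure ℝ) [IsFiniteMeasure w] :
    generator K F β k (fun _ => 1) w ≤ Fbar * ((k : ℝ) - 1) * β.real univ * w.real univ := by
  have h1 : ∫ x, ∫ y, coagOp K (fun _ => 1) x y ∂w ∂w ≤ 0 :=
    integral_nonpos fun x => integral_nonpos fun y => by
      simp only [coagOp, Pi.zero_apply]
      linarith [hK.coag_nonneg x y]
  have h2 : ∫ x, fragOp F β k (fun _ => 1) x ∂w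
      ≤ ∫ _, Fbar * ((k : ℝ) - 1) * β.real univ ∂w :=
    integral_mono (integrable_of_abs_le (hK.measurable_fragOp measurable_const)
      (hK.abs_fragOp_le (c := 1) (by simp))) (integrable_const _) (hK.fragOp_one_le hk)
  rw [integral_const, smul_eq_mul] at h2
  rw [generator, quadForm]
  linarith

/-- The integrating factor of the loss rate `γ`. -/
noncomputable def integratingFactor (γ : ℝ → ℝ) (s : ℝ) : ℝ :=
  Real.exp (∫ u in (0 : ℝ)..s, γ u)

theorem integratingFactor_pos (s : ℝ) : 0 < integratingFactor γ s := Real.exp_pos _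

theorem hasDerivAt_integratingFactor (hγ : Continuous γ) (s : ℝ) :
    HasDerivAt (integratingFactor γ) (integratingFactor γ s * γ s) s :=
  (hγ.integral_hasStrictDerivAt 0 s).hasDerivAt.exp

theorem continuous_integratingFactor (hγ : Continuous γ) : Continuous (integratingFactor γ) :=
  continuous_iff_continuousAt.2 fun s => (hasDerivAt_integratingFactor hγ s).continuousAt

/-- Undo the integrating factor. -/
noncomputable def descale (γ : ℝ → ℝ) (s : ℝ) (v : Measure ℝ) : Measure ℝ :=
  ENNReal.ofReal (integratingFactor γ s)⁻¹ • v

instance (s : ℝ) (v : Measure ℝ) [IsFiniteMeasure v] : IsFiniteMeasure (descale γ s v) :=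
  Measure.smul_finite _ ENNReal.ofReal_ne_top

theorem descale_real (s : ℝ) (v : Measure ℝ) (A : Set ℝ) :
    (descale γ s v).real A = (integratingFactor γ s)⁻¹ * v.real A := by
  rw [descale, measureReal_ennreal_smul_apply,
    ENNReal.toReal_ofReal (inv_nonneg.2 (integratingFactor_pos s).le)]

theorem integral_descale (s : ℝ) (v : Measure ℝ) (φ : ℝ → ℝ) :
    ∫ x, φ x ∂(descale γ s v) = (integratingFactor γ s)⁻¹ * ∫ x, φ x ∂v := by
  rw [descale, integral_smul_measure,
    ENNReal.toReal_ofReal (inv_nonneg.2 (integratingFactor_pos s).le), smul_eq_mul]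

theorem SetwiseClose.descale {v w : Measure ℝ} {d : ℝ} (h : SetwiseClose v w d) (s : ℝ) :
    SetwiseClose (descale γ s v) (descale γ s w) ((integratingFactor γ s)⁻¹ * d) := by
  intro A hA
  have h0 := inv_nonneg.2 (integratingFactor_pos (γ := γ) s).le
  rw [descale_real, descale_real, ← mul_sub, abs_mul, abs_of_nonneg h0]
  exact mul_le_mul_of_nonneg_left (h A hA) h0

theorem measurable_descale (hγ : Continuous γ) {v : ℝ → Measure ℝ} (hv : Measurable v) :
    Measurable fun s => descale γ s (v s) :=
  Measure.measurable_of_measurable_coe _ fun _ hA =>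
    ((continuous_integratingFactor hγ).measurable.inv.ennreal_ofReal).mul
      ((Measure.measurable_coe hA).comp hv)

/-- The gain operator conjugated by the integrating factor. -/
noncomputable def rescaledGain (K : ℝ → ℝ → ℝ) (F : ℝ → ℝ) (β : Measure DislocationSpace) (k : ℕ)
    (γ : ℝ → ℝ) (s : ℝ) (v : Measure ℝ) : Measure ℝ :=
  ENNReal.ofReal (integratingFactor γ s) • gainMeasure K F β k (γ s) (descale γ s v)

variable [IsFiniteMeasure β]

theorem IsBddKernel.isFiniteMeasure_rescaledGain (hK : IsBddKernel K F Kbar Fbar) (s : ℝ)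
    (v : Measure ℝ) [IsFiniteMeasure v] : IsFiniteMeasure (rescaledGain K F β k γ s v) := by
  have := hK.isFiniteMeasure_gainMeasure (β := β) (k := k) (γ s) (descale γ s v)
  exact Measure.smul_finite _ ENNReal.ofReal_ne_top

theorem IsBddKernel.integral_rescaledGain (hK : IsBddKernel K F Kbar Fbar) {s : ℝ}
    {v : Measure ℝ} [IsFiniteMeasure v]
    (hγ : Fbar * β.real univ + Kbar * (descale γ s v).real univ ≤ γ s) {φ : ℝ → ℝ} {c : ℝ}
    (hφ : Measurable φ) (hc : ∀ x, |φ x| ≤ c) :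
    ∫ x, φ x ∂(rescaledGain K F β k γ s v) = integratingFactor γ s *
      (generator K F β k φ (descale γ s v) + γ s * ∫ x, φ x ∂(descale γ s v)) := by
  rw [rescaledGain, integral_smul_measure, hK.integral_gainMeasure hγ hφ hc,
    ENNReal.toReal_ofReal (integratingFactor_pos s).le, smul_eq_mul]

theorem descale_mass_le {m : ℝ → ℝ} {s : ℝ} {v : Measure ℝ}
    (hv : v.real univ ≤ m s * integratingFactor γ s) : (descale γ s v).real univ ≤ m s := by
  rwa [descale_real, inv_mul_le_iff₀ (integratingFactor_pos s), mul_comm]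

theorem IsBddKernel.isPositiveField_rescaledGain (hK : IsBddKernel K F Kbar Fbar) (hk : 1 ≤ k)
    {m : ℝ → ℝ} (hm0 : ∀ s, 0 ≤ m s)
    (hm : ∀ s, HasDerivAt m (Fbar * ((k : ℝ) - 1) * β.real univ * m s) s)
    (hγ : ∀ s, γ s = Fbar * β.real univ + Kbar * m s) :
    IsPositiveField (rescaledGain K F β k γ) (fun s => m s * integratingFactor γ s)
      (fun s => (Fbar * ((k : ℝ) - 1) * β.real univ + γ s) * (m s * integratingFactor γ s)) := by
  have hmc : Continuous m := continuous_iff_continuousAt.2 fun s => (hm s).continuousAt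
  have hγc : Continuous γ := by
    rw [funext hγ]
    exact continuous_const.add (continuous_const.mul hmc)
  have hK0 := hK.coag_bound_nonneg
  have hF0 := hK.frag_bound_nonneg
  have hk' : (0 : ℝ) ≤ (k : ℝ) - 1 := by
    rw [sub_nonneg]
    exact_mod_cast hk
  have ha0 : 0 ≤ Fbar * ((k : ℝ) - 1) * β.real univ := by positivity
  have hγ0 : ∀ s, 0 ≤ γ s := fun s => by
    rw [hγ]
    have := hm0 s
    positivity
  have hrate : ∀ {s : ℝ} {v : Measure ℝ}, v.real univ ≤ m s * integratingFactor γ s →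
      Fbar * β.real univ + Kbar * (descale γ s v).real univ ≤ γ s := fun {s v} hv => by
    rw [hγ s]
    gcongr
    exact descale_mass_le hv
  have hreal : ∀ {s : ℝ} {v : Measure ℝ}, IsFiniteMeasure v →
      v.real univ ≤ m s * integratingFactor γ s → ∀ {A : Set ℝ}, MeasurableSet A →
      (rescaledGain K F β k γ s v).real A = integratingFactor γ s *
        (generator K F β k (A.indicator 1) (descale γ s v)
          + γ s * (descale γ s v).real A) := by
    intro s v _ hv A hA
    rw [← integral_indicator_one hA, ← integral_indicator_one hA]
    exact hK.integral_rescaledGain (hrate hv) (measurable_one.indicator hA) (c := 1)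
      fun x => by by_cases hx : x ∈ A <;> simp [hx]
  refine ⟨fun s => ?_, by have := continuous_integratingFactor hγc; fun_prop, fun s _ => ?_,
    fun s v _ => hK.isFiniteMeasure_rescaledGain s v, fun s v hvf _ hv => ?_,
    fun v hv hvf => ?_, fun T _ => ?_⟩
  · exact ((hm s).mul (hasDerivAt_integratingFactor hγc s)).congr_deriv (by ring)
  · exact mul_nonneg (add_nonneg ha0 (hγ0 s)) (mul_nonneg (hm0 s) (integratingFactor_pos s).le)
  · have h1 := hK.generator_one_le (β := β) hk (descale γ s v)
    rw [hreal hvf hv MeasurableSet.univ, indicator_univ]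
    calc _ ≤ integratingFactor γ s * ((Fbar * ((k : ℝ) - 1) * β.real univ + γ s)
            * (descale γ s v).real univ) := by
          refine mul_le_mul_of_nonneg_left ?_ (integratingFactor_pos s).le
          rw [add_mul]
          exact add_le_add_left h1 _
      _ ≤ integratingFactor γ s * ((Fbar * ((k : ℝ) - 1) * β.real univ + γ s) * m s) := by
          refine mul_le_mul_of_nonneg_left ?_ (integratingFactor_pos s).le
          exact mul_le_mul_of_nonneg_left (descale_mass_le hv) (add_nonneg ha0 (hγ0 s))
      _ = _ := by ring
  · have := hK.measurable_gainMeasure (β := β) (k := k) hγc.measurable (measurable_descale hγc hv)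
    exact Measure.measurable_of_measurable_coe _ fun A hA =>
      (continuous_integratingFactor hγc).measurable.ennreal_ofReal.mul
        ((Measure.measurable_coe hA).comp this)
  · obtain ⟨C, hC⟩ := (isCompact_Icc (a := (0 : ℝ)) (b := T)).exists_bound_of_continuousOn
      hmc.continuousOn
    have hmC : ∀ s ∈ Icc 0 T, m s ≤ C := fun s hs => (le_abs_self _).trans (hC s hs)
    have hG0 : 0 ≤ genLip Kbar Fbar β k |C| := by
      rw [genLip]
      positivity
    refine ⟨genLip Kbar Fbar β k |C| + (Fbar * β.real univ + Kbar * |C|) + 1, by positivity,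
      fun s hs v w hvf hwf hv hw d hd A hA => ?_⟩
    have hd0 : 0 ≤ d := (abs_nonneg _).trans (hd A hA)
    have hmC' : m s ≤ |C| := (hmC s hs).trans (le_abs_self _)
    have hclose := hd.descale (γ := γ) s
    have h1 := hK.abs_generator_sub_le (β := β) (k := k) (φ := A.indicator 1)
      (measurable_one.indicator hA) (fun x => by by_cases hx : x ∈ A <;> simp [hx])
      ((descale_mass_le hv).trans hmC') ((descale_mass_le hw).trans hmC') hclose
    have h2 := hclose A hA
    have hD := integratingFactor_pos (γ := γ) s
    rw [hreal hvf hv hA, hreal hwf hw hA, ← mul_sub, abs_mul, abs_of_pos hD]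
    have h3 : |generator K F β k (A.indicator 1) (descale γ s v) + γ s * (descale γ s v).real A
        - (generator K F β k (A.indicator 1) (descale γ s w) + γ s * (descale γ s w).real A)|
        ≤ (genLip Kbar Fbar β k |C| + γ s) * ((integratingFactor γ s)⁻¹ * d) := by
      rw [add_sub_add_comm, ← mul_sub, add_mul]
      refine (abs_add_le _ _).trans (add_le_add h1 ?_)
      rw [abs_mul, abs_of_nonneg (hγ0 s)]
      exact mul_le_mul_of_nonneg_left h2 (hγ0 s)
    have hγC : γ s ≤ Fbar * β.real univ + Kbar * |C| := by
      rw [hγ s]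
      gcongr
    calc _ ≤ integratingFactor γ s *
          ((genLip Kbar Fbar β k |C| + γ s) * ((integratingFactor γ s)⁻¹ * d)) :=
          mul_le_mul_of_nonneg_left h3 hD.le
      _ = (genLip Kbar Fbar β k |C| + γ s) * d := by
          field_simp
      _ ≤ _ := by
          refine mul_le_mul_of_nonneg_right ?_ hd0
          linarith

end Field

section FixedPoint

variable {X : Type*} [MeasurableSpace X] {H : ℝ → Measure X → Measure X} {M M' : ℝ → ℝ}
  {μ0 : Measure X} {v : ℝ → Measure X}

theorem IsPositiveField.integral_fixedPoint (hH : IsPositiveField H M M') [IsFiniteMeasure μ0]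
    (hv : IsAdmissible M v) (hfix : ∀ t, 0 ≤ t → v t = picardStep H μ0 v t) {φ : X → ℝ}
    (hφ : Measurable φ) {c : ℝ} (hc : ∀ x, |φ x| ≤ c) {t : ℝ} (ht : 0 ≤ t) :
    ∫ x, φ x ∂(v t) = ∫ x, φ x ∂μ0 + ∫ s in (0 : ℝ)..t, ∫ x, φ x ∂(H s (v s)) := by
  obtain ⟨b, hb, hbound⟩ := hH.exists_mass_le t
  have : ∀ s, IsFiniteMeasure (H s (v s)) := fun s => hH.finite s _ (hv.finite s)
  obtain ⟨h1, h2⟩ := integral_bind_of_abs_le (hH.measurable v hv.measurable hv.finite) hb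
    (hbound v hv) hφ hc
  rw [hfix t ht, picardStep, integral_add_measure (integrable_of_abs_le hφ hc)
    (integrable_of_abs_le hφ hc), h2, intervalIntegral.integral_of_le ht]

theorem IsPositiveField.setwiseClose_fixedPoint (hH : IsPositiveField H M M')
    [IsFiniteMeasure μ0] (hv : IsAdmissible M v)
    (hfix : ∀ t, 0 ≤ t → v t = picardStep H μ0 v t) {s t : ℝ} (hs : 0 ≤ s) (ht : 0 ≤ t) :
    SetwiseClose (v s) (v t) |M s - M t| := by
  intro A hA
  wlog hst : s ≤ t generalizing s t
  · rw [abs_sub_comm, abs_sub_comm (M s)]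
    exact this ht hs (le_of_not_ge hst)
  have hint : ∀ a b, 0 ≤ a → a ≤ b →
      IntervalIntegrable (fun s => (H s (v s)).real A) volume a b := fun a b ha hab => by
    rw [intervalIntegrable_iff_integrableOn_Ioc_of_le hab]
    exact (hH.integrableOn hv hA b).mono_set (Ioc_subset_Ioc_left ha)
  have hreal : ∀ t, 0 ≤ t → (v t).real A = μ0.real A + ∫ s in (0 : ℝ)..t, (H s (v s)).real A :=
    fun t ht => by
      conv_lhs => rw [hfix t ht]
      rw [hH.real_picardStep hv hA, intervalIntegral.integral_of_le ht]
  have hM : ∫ u in s..t, M' u = M t - M s :=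
    intervalIntegral.integral_eq_sub_of_hasDerivAt (fun u _ => hH.hasDerivAt u)
      (hH.continuous_deriv.intervalIntegrable _ _)
  have hsplit := intervalIntegral.integral_add_adjacent_intervals (hint 0 s le_rfl hs)
    (hint s t hs hst)
  have h0 : 0 ≤ ∫ u in s..t, (H u (v u)).real A :=
    intervalIntegral.integral_nonneg hst fun _ _ => measureReal_nonneg
  have h1 : ∫ u in s..t, (H u (v u)).real A ≤ ∫ u in s..t, M' u :=
    intervalIntegral.integral_mono_on hst (hint s t hs hst)
      (hH.continuous_deriv.intervalIntegrable _ _)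
      fun u hu => hH.mass_bound hv (hs.trans hu.1)
  rw [hreal s hs, hreal t ht, abs_sub_comm, abs_sub_comm (M s), abs_of_nonneg (by linarith),
    abs_of_nonneg (by linarith)]
  linarith

theorem IsPositiveField.continuousOn_quadForm (hH : IsPositiveField H M M') [IsFiniteMeasure μ0]
    (hv : IsAdmissible M v) (hfix : ∀ t, 0 ≤ t → v t = picardStep H μ0 v t)
    {A : X → X → ℝ} {B : X → ℝ} (hA : Measurable (Function.uncurry A)) (hB : Measurable B)
    {a b : ℝ} (ha0 : 0 ≤ a) (hb0 : 0 ≤ b) (ha : ∀ x y, |A x y| ≤ a) (hb : ∀ x, |B x| ≤ b) :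
    ContinuousOn (fun s => quadForm A B (v s)) (Ici 0) := by
  intro t ht
  have hMt : Tendsto M (𝓝[Ici 0] t) (𝓝 (M t)) :=
    (hH.hasDerivAt t).continuousAt.continuousWithinAt
  rw [ContinuousWithinAt, tendsto_iff_norm_sub_tendsto_zero]
  refine squeeze_zero' (g := fun s => (6 * a * (M t + 1) + 3 * b) * |M s - M t|)
    (Eventually.of_forall fun _ => norm_nonneg _) ?_ ?_
  · filter_upwards [self_mem_nhdsWithin, hMt.eventually_le_const (lt_add_one _)] with s hs hMs
    have := hv.finite s
    have := hv.finite t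
    exact abs_quadForm_sub_le hA hB ha0 hb0 ha hb ((hv.mass s hs).trans hMs)
      ((hv.mass t ht).trans (lt_add_one _).le) (hH.setwiseClose_fixedPoint hv hfix hs ht)
  · have := ((hMt.sub_const (M t)).abs).const_mul (6 * a * (M t + 1) + 3 * b)
    simpa using this

theorem IsPositiveField.hasDerivWithinAt_fixedPoint (hH : IsPositiveField H M M')
    [IsFiniteMeasure μ0] (hv : IsAdmissible M v)
    (hfix : ∀ t, 0 ≤ t → v t = picardStep H μ0 v t) {φ : X → ℝ} (hφ : Measurable φ) {c : ℝ}
    (hc : ∀ x, |φ x| ≤ c) (hcont : ContinuousOn (fun s => ∫ x, φ x ∂(H s (v s))) (Ici 0))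
    {t : ℝ} (ht : 0 ≤ t) :
    HasDerivWithinAt (fun s => ∫ x, φ x ∂(v s)) (∫ x, φ x ∂(H t (v t))) (Ici 0) t := by
  have hcont' : Continuous fun s => ∫ x, φ x ∂(H (max s 0) (v (max s 0))) :=
    hcont.comp_continuous (continuous_id.max continuous_const) fun s => mem_Ici.2 (le_max_right _ _)
  have hderiv := ((hcont'.integral_hasStrictDerivAt 0 t).hasDerivAt.const_add
    (∫ x, φ x ∂μ0)).hasDerivWithinAt (s := Ici 0)
  have heq : ∀ s ∈ Ici (0 : ℝ), ∫ x, φ x ∂(v s) = ∫ x, φ x ∂μ0 +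
      ∫ u in (0 : ℝ)..s, ∫ x, φ x ∂(H (max u 0) (v (max u 0))) := fun s hs => by
    rw [hH.integral_fixedPoint hv hfix hφ hc hs]
    congr 1
    refine intervalIntegral.integral_congr fun u hu => ?_
    rw [uIcc_of_le hs] at hu
    simp only [max_eq_left hu.1]
  rw [max_eq_left ht] at hderiv
  exact hderiv.congr heq (heq t ht)

end FixedPoint

section Solution

variable {K : ℝ → ℝ → ℝ} {F : ℝ → ℝ} {Kbar Fbar : ℝ} {β : Measure DislocationSpace}
  {k : ℕ}

/-- Weak solutions of the equation with kernels defined on the whole line and a fragmentation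
operator truncated to `k` fragments. -/
structure IsGeneratorSolution (K : ℝ → ℝ → ℝ) (F : ℝ → ℝ) (β : Measure DislocationSpace) (k : ℕ)
    (w : ℝ → Measure ℝ) : Prop where
  finite : ∀ t, 0 ≤ t → IsFiniteMeasure (w t)
  hasDerivWithinAt : ∀ φ : ℝ → ℝ, Measurable φ → (∃ c : ℝ, ∀ x, |φ x| ≤ c) → ∀ t, 0 ≤ t →
    HasDerivWithinAt (fun s => ∫ x, φ x ∂(w s)) (generator K F β k φ (w t)) (Ici 0) t

theorem generator_descale {γ : ℝ → ℝ} (φ : ℝ → ℝ) (s : ℝ) (v : Measure ℝ) :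
    generator K F β k φ (descale γ s v)
      = (integratingFactor γ s)⁻¹ * ((integratingFactor γ s)⁻¹ *
          quadForm (coagOp K φ) (fun _ => 0) v)
        + (integratingFactor γ s)⁻¹ * quadForm (fun _ _ => 0) (fragOp F β k φ) v := by
  simp only [generator, quadForm, integral_descale, integral_const_mul, integral_zero,
    add_zero, zero_add]

theorem IsGeneratorSolution.continuousOn {w : ℝ → Measure ℝ}
    (hw : IsGeneratorSolution K F β k w) {φ : ℝ → ℝ} (hφ : Measurable φ)
    (hc : ∃ c : ℝ, ∀ x, |φ x| ≤ c) : ContinuousOn (fun s => ∫ x, φ x ∂(w s)) (Ici 0) :=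
  fun t ht => (hw.hasDerivWithinAt φ hφ hc t ht).continuousWithinAt

theorem IsGeneratorSolution.measure_Iic_eq_zero {w : ℝ → Measure ℝ}
    (hw : IsGeneratorSolution K F β k w) (hKpos : ∀ x y, ¬ (0 < x ∧ 0 < y) → K x y = 0)
    (hFpos : ∀ x, ¬ 0 < x → F x = 0) (h0 : w 0 (Iic 0) = 0) {t : ℝ} (ht : 0 ≤ t) :
    w t (Iic 0) = 0 := by
  have hφ : Measurable ((Iic (0 : ℝ)).indicator (1 : ℝ → ℝ)) :=
    measurable_one.indicator measurableSet_Iic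
  have hc : ∃ c : ℝ, ∀ x, |(Iic (0 : ℝ)).indicator (1 : ℝ → ℝ) x| ≤ c :=
    ⟨1, fun x => by by_cases hx : x ∈ Iic (0 : ℝ) <;> simp [hx]⟩
  have hpos : ∀ x, 0 < x → (Iic (0 : ℝ)).indicator (1 : ℝ → ℝ) x = 0 := fun x hx =>
    indicator_of_notMem (notMem_Iic.2 hx) _
  have hcoag : ∀ x y, coagOp K ((Iic (0 : ℝ)).indicator 1) x y = 0 := fun x y => by
    by_cases h : 0 < x ∧ 0 < y
    · simp [coagOp, hpos x h.1, hpos _ (add_pos h.1 h.2)]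
    · simp [coagOp, hKpos x y h]
  have hfrag : ∀ x, fragOp F β k ((Iic (0 : ℝ)).indicator 1) x = 0 := fun x => by
    by_cases h : 0 < x
    · have : ∀ y : ℝ, (if 0 < y then (Iic (0 : ℝ)).indicator (1 : ℝ → ℝ) y else 0) = 0 :=
        fun y => by
          split_ifs with hy
          exacts [hpos y hy, rfl]
      simp [fragOp, hpos x h, this]
    · simp [fragOp, hFpos x h]
  have hgen : ∀ v : Measure ℝ, generator K F β k ((Iic (0 : ℝ)).indicator 1) v = 0 := fun v => by
    simp [generator, quadForm, hcoag, hfrag]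
  have hconst := constant_of_has_deriv_right_zero
    ((hw.continuousOn hφ hc).mono Icc_subset_Ici_self)
    (fun s hs => by
      have := hw.hasDerivWithinAt _ hφ hc s hs.1
      rw [hgen] at this
      exact this.mono (Ici_subset_Ici.2 hs.1)) t ⟨ht, le_rfl⟩
  rw [integral_indicator_one measurableSet_Iic, integral_indicator_one measurableSet_Iic,
    measureReal_def (w 0), h0] at hconst
  have := hw.finite t ht
  exact (measureReal_eq_zero_iff).1 (hconst.trans ENNReal.toReal_zero)

variable [IsFiniteMeasure β]

theorem IsBddKernel.exists_isGeneratorSolution (hK : IsBddKernel K F Kbar Fbar) (hk : 1 ≤ k)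
    (μin : Measure ℝ) [IsFiniteMeasure μin] :
    ∃ w : ℝ → Measure ℝ, w 0 = μin ∧ IsGeneratorSolution K F β k w ∧ ∀ t, 0 ≤ t →
      (w t).real univ ≤
        μin.real univ * Real.exp (Fbar * ((k : ℝ) - 1) * β.real univ * t) := by
  set a := Fbar * ((k : ℝ) - 1) * β.real univ
  let m : ℝ → ℝ := fun t => μin.real univ * Real.exp (a * t)
  let γ : ℝ → ℝ := fun t => Fbar * β.real univ + Kbar * m t
  have hm : ∀ s, HasDerivAt m (a * m s) s := fun s =>
    ((((hasDerivAt_id s).const_mul a).exp).const_mul (μin.real univ)).congr_deriv (by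
      simp only [m, id]
      ring)
  have hm0 : ∀ s, 0 ≤ m s := fun s => mul_nonneg measureReal_nonneg (Real.exp_pos _).le
  have hγ : Continuous γ := by fun_prop
  have hH := hK.isPositiveField_rescaledGain (β := β) hk hm0 hm (γ := γ) fun _ => rfl
  have hone : integratingFactor γ 0 = 1 := by simp [integratingFactor]
  obtain ⟨v, hv, hfix⟩ := hH.exists_fixedPoint (μ0 := μin) (by simp [m, hone])
  have hfin := hv.finite
  have hmass : ∀ t, 0 ≤ t → (descale γ t (v t)).real univ ≤ m t := fun t ht =>
    descale_mass_le (hv.mass t ht)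
  refine ⟨fun t => descale γ t (v t), ?_, ⟨fun t _ => inferInstance, ?_⟩, hmass⟩
  · simp [hfix 0 le_rfl, picardStep, descale, hone]
  · rintro φ hφ ⟨c, hc⟩ t ht
    have hc0 : 0 ≤ c := (abs_nonneg _).trans (hc 0)
    have hK0 := hK.coag_bound_nonneg
    have hF0 := hK.frag_bound_nonneg
    have hgain : ∀ s, 0 ≤ s → ∫ x, φ x ∂(rescaledGain K F β k γ s (v s))
        = integratingFactor γ s * (generator K F β k φ (descale γ s (v s))
          + γ s * ∫ x, φ x ∂(descale γ s (v s))) := fun s hs =>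
      hK.integral_rescaledGain (add_le_add_right
        (mul_le_mul_of_nonneg_left (hmass s hs) hK0) _) hφ hc
    have hD := continuous_integratingFactor hγ
    have hDinv : Continuous fun s => (integratingFactor γ s)⁻¹ :=
      hD.inv₀ fun s => (integratingFactor_pos s).ne'
    have hcoag := hH.continuousOn_quadForm hv hfix (hK.measurable_coagOp hφ)
      (measurable_const (a := (0 : ℝ))) (by positivity) le_rfl (hK.abs_coagOp_le hc) (by simp)
    have hfrag := hH.continuousOn_quadForm hv hfix (A := fun _ _ => (0 : ℝ)) measurable_const
      (hK.measurable_fragOp (β := β) (k := k) hφ) le_rfl (by positivity) (by simp)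
      (hK.abs_fragOp_le hc)
    have htest := hH.continuousOn_quadForm hv hfix (A := fun _ _ => (0 : ℝ)) measurable_const
      hφ le_rfl hc0 (by simp) hc
    simp only [quadForm, integral_zero, zero_add] at htest
    have hcont : ContinuousOn (fun s => ∫ x, φ x ∂(rescaledGain K F β k γ s (v s))) (Ici 0) := by
      refine ContinuousOn.congr (f := fun s => integratingFactor γ s *
        ((integratingFactor γ s)⁻¹ * ((integratingFactor γ s)⁻¹ *
          quadForm (coagOp K φ) (fun _ => 0) (v s))
        + (integratingFactor γ s)⁻¹ * quadForm (fun _ _ => 0) (fragOp F β k φ) (v s)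
        + γ s * ((integratingFactor γ s)⁻¹ * ∫ x, φ x ∂(v s)))) ?_ fun s hs => ?_
      · have h1 := hD.continuousOn (s := Ici 0)
        have h2 := hDinv.continuousOn (s := Ici 0)
        exact h1.mul (((h2.mul (h2.mul hcoag)).add (h2.mul hfrag)).add
          (hγ.continuousOn.mul (h2.mul htest)))
      · rw [hgain s hs, generator_descale, integral_descale]
    have hderiv := (((hasDerivAt_integratingFactor hγ t).inv
      (integratingFactor_pos t).ne').hasDerivWithinAt (s := Ici 0)).mul
      (hH.hasDerivWithinAt_fixedPoint hv hfix hφ hc hcont ht)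
    simp only [integral_descale]
    refine hderiv.congr_deriv ?_
    rw [hgain t ht, integral_descale, Pi.inv_apply]
    have := (integratingFactor_pos (γ := γ) t).ne'
    field_simp
    ring

theorem IsBddKernel.generatorSolution_unique (hK : IsBddKernel K F Kbar Fbar)
    {v w : ℝ → Measure ℝ} (hv : IsGeneratorSolution K F β k v)
    (hw : IsGeneratorSolution K F β k w) (h0 : v 0 = w 0) {T : ℝ} (hT : 0 ≤ T) : v T = w T := by
  have hmass : ∀ {w : ℝ → Measure ℝ}, IsGeneratorSolution K F β k w →
      ∃ C, ∀ t ∈ Icc 0 T, (w t).real univ ≤ C := fun {w} hw => by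
    have hcont := hw.continuousOn (φ := fun _ => 1) measurable_const ⟨1, by simp⟩
    obtain ⟨C, hC⟩ := isCompact_Icc.exists_bound_of_continuousOn
      (hcont.mono Icc_subset_Ici_self)
    exact ⟨C, fun t ht => (le_abs_self _).trans (by simpa using hC t ht)⟩
  obtain ⟨C₁, hC₁⟩ := hmass hv
  obtain ⟨C₂, hC₂⟩ := hmass hw
  set m := max C₁ C₂
  have hvm : ∀ t ∈ Icc 0 T, (v t).real univ ≤ m := fun t ht => (hC₁ t ht).trans (le_max_left _ _)
  have hwm : ∀ t ∈ Icc 0 T, (w t).real univ ≤ m := fun t ht => (hC₂ t ht).trans (le_max_right _ _)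
  have hm0 : 0 ≤ m := measureReal_nonneg.trans (hvm 0 ⟨le_rfl, hT⟩)
  set L := genLip Kbar Fbar β k m
  have hL0 : 0 ≤ L := by
    have := hK.coag_bound_nonneg
    have := hK.frag_bound_nonneg
    simp only [L, genLip]
    positivity
  have hclose : ∀ n : ℕ, ∀ t ∈ Icc 0 T,
      SetwiseClose (v t) (w t) (m * Real.exp (2 * L * t) * (1 / 2) ^ n) := by
    intro n
    induction n with
    | zero =>
      intro t ht A _
      have := hv.finite t ht.1
      have := hw.finite t ht.1
      have h1 : (v t).real A ≤ m := (measureReal_mono (subset_univ A)).trans (hvm t ht)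
      have h2 : (w t).real A ≤ m := (measureReal_mono (subset_univ A)).trans (hwm t ht)
      have h3 : m ≤ m * Real.exp (2 * L * t) :=
        le_mul_of_one_le_right hm0 (Real.one_le_exp (mul_nonneg (by positivity) ht.1))
      rw [pow_zero, mul_one, abs_le]
      constructor <;> linarith [measureReal_nonneg (μ := v t) (s := A),
        measureReal_nonneg (μ := w t) (s := A)]
    | succ n ih =>
      intro t ht A hA
      have hφ : Measurable (A.indicator (1 : ℝ → ℝ)) := measurable_one.indicator hA
      have hc : ∀ x, |A.indicator (1 : ℝ → ℝ) x| ≤ 1 := fun x => by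
        by_cases hx : x ∈ A <;> simp [hx]
      have hexp : ∀ s, HasDerivAt (fun s => m * Real.exp (2 * L * s) * (1 / 2) ^ (n + 1))
          (L * (m * Real.exp (2 * L * s) * (1 / 2) ^ n)) s := fun s =>
        (((((hasDerivAt_id s).const_mul (2 * L)).exp).const_mul m).mul_const _).congr_deriv (by
          simp only [id]
          ring)
      have key := image_norm_le_of_norm_deriv_right_le_deriv_boundary (a := 0) (b := T)
        (f := fun s => ∫ x, A.indicator 1 x ∂(v s) - ∫ x, A.indicator 1 x ∂(w s))
        (f' := fun s => generator K F β k (A.indicator 1) (v s)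
          - generator K F β k (A.indicator 1) (w s))
        (((hv.continuousOn hφ ⟨1, hc⟩).sub (hw.continuousOn hφ ⟨1, hc⟩)).mono Icc_subset_Ici_self)
        (fun s hs => ((hv.hasDerivWithinAt _ hφ ⟨1, hc⟩ s hs.1).sub
          (hw.hasDerivWithinAt _ hφ ⟨1, hc⟩ s hs.1)).mono (Ici_subset_Ici.2 hs.1))
        (by
          rw [h0, sub_self, norm_zero]
          positivity)
        hexp
        (fun s hs => by
          have := hv.finite s hs.1
          have := hw.finite s hs.1
          have hs' := Ico_subset_Icc_self hs
          exact hK.abs_generator_sub_le hφ hc (hvm s hs') (hwm s hs') (ih s hs')) ht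
      simpa only [integral_indicator_one hA, Real.norm_eq_abs] using key
  ext A hA
  have := hv.finite T hT
  have := hw.finite T hT
  have hlim : Tendsto (fun n : ℕ => m * Real.exp (2 * L * T) * (1 / 2 : ℝ) ^ n) atTop (𝓝 0) := by
    simpa using (tendsto_pow_atTop_nhds_zero_of_lt_one (r := (1 / 2 : ℝ)) (by norm_num)
      (by norm_num)).const_mul (m * Real.exp (2 * L * T))
  have hzero := ge_of_tendsto' hlim fun n => hclose n T ⟨hT, le_rfl⟩ A hA
  have heq : (v T).real A = (w T).real A := sub_eq_zero.1 (abs_nonpos_iff.1 hzero)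
  exact (ENNReal.toReal_eq_toReal_iff' (measure_ne_top _ _) (measure_ne_top _ _)).1 heq

end Solution

section Restriction

variable {K : ℝ → ℝ → ℝ} {F : ℝ → ℝ} {Kbar Fbar : ℝ} {β : Measure DislocationSpace}
  {k : ℕ}

/-- Extension by zero of a coagulation kernel on `(0, ∞)²`. -/
noncomputable def posCoag (K : ℝ → ℝ → ℝ) (x y : ℝ) : ℝ :=
  if 0 < x ∧ 0 < y then K x y else 0

/-- Extension by zero of a fragmentation rate on `(0, ∞)`. -/
noncomputable def posFrag (F : ℝ → ℝ) (x : ℝ) : ℝ :=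
  if 0 < x then F x else 0

theorem isBddKernel_pos (hKbar : 0 ≤ Kbar) (hFbar : 0 ≤ Fbar)
    (hKmeas : Measurable (Function.uncurry K)) (hKnn : ∀ x y : ℝ, 0 < x → 0 < y → 0 ≤ K x y)
    (hKbdd : ∀ x y : ℝ, 0 < x → 0 < y → K x y ≤ Kbar) (hFmeas : Measurable F)
    (hFnn : ∀ x : ℝ, 0 < x → 0 ≤ F x) (hFbdd : ∀ x : ℝ, 0 < x → F x ≤ Fbar) :
    IsBddKernel (posCoag K) (posFrag F) Kbar Fbar where
  measurable_coag := Measurable.ite ((measurableSet_lt measurable_const measurable_fst).inter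
    (measurableSet_lt measurable_const measurable_snd)) hKmeas measurable_const
  coag_nonneg x y := by
    rw [posCoag]
    split_ifs with h
    exacts [hKnn x y h.1 h.2, le_rfl]
  coag_le x y := by
    rw [posCoag]
    split_ifs with h
    exacts [hKbdd x y h.1 h.2, hKbar]
  measurable_frag := Measurable.ite (measurableSet_lt measurable_const measurable_id) hFmeas
    measurable_const
  frag_nonneg x := by
    rw [posFrag]
    split_ifs with h
    exacts [hFnn x h, le_rfl]
  frag_le x := by
    rw [posFrag]
    split_ifs with h
    exacts [hFbdd x h, hFbar]

theorem ae_pos {μ : Measure ℝ} (hμ : μ (Iic 0) = 0) : ∀ᵐ x ∂μ, 0 < x := by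
  rw [ae_iff]
  simpa [Iic_def] using hμ

theorem restrict_Ioi_eq_self {μ : Measure ℝ} (hμ : μ (Iic 0) = 0) :
    μ.restrict (Ioi 0) = μ :=
  Measure.restrict_eq_self_of_ae_mem (ae_pos hμ)

theorem tsum_fragment_eq_sum (φ : ℝ → ℝ) {θ : DislocationSpace} (hθ : ¬ 0 < θ.1 k) {x : ℝ}
    (hx : 0 < x) :
    ∑' i : ℕ, (if 0 < θ.1 i * x then φ (θ.1 i * x) else 0)
      = ∑ i ∈ Finset.range k, if 0 < θ.1 i * x then φ (θ.1 i * x) else 0 := by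
  refine tsum_eq_sum fun i hi => if_neg ?_
  rw [Finset.mem_range, not_lt] at hi
  rw [mul_pos_iff_of_pos_right hx]
  exact fun h => hθ (h.trans_le (θ.2.2.1 hi))

theorem generator_pos_eq (hβ : β {θ : DislocationSpace | 0 < θ.1 k} = 0) {μ : Measure ℝ}
    (hμ : μ (Iic 0) = 0) (φ : ℝ → ℝ) :
    (∫ x in Ioi (0 : ℝ), (∫ y in Ioi (0 : ℝ), K x y * ((1 / 2) * φ (x + y) - φ x) ∂μ) ∂μ)
      + ∫ x in Ioi (0 : ℝ), F x * ∫ θ : DislocationSpace,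
          ((∑' i : ℕ, if 0 < θ.1 i * x then φ (θ.1 i * x) else 0) - φ x) ∂β ∂μ
      = generator (posCoag K) (posFrag F) β k φ μ := by
  rw [restrict_Ioi_eq_self hμ, generator, quadForm]
  have hβ' : ∀ᵐ θ ∂β, ¬ 0 < θ.1 k := by
    rw [ae_iff]
    simpa using hβ
  congr 1
  · refine integral_congr_ae ((ae_pos hμ).mono fun x hx =>
      integral_congr_ae ((ae_pos hμ).mono fun y hy => ?_))
    simp [coagOp, posCoag, hx, hy]
  · refine integral_congr_ae ((ae_pos hμ).mono fun x hx => ?_)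
    simp only [fragOp, posFrag, hx, if_true]
    congr 1
    refine integral_congr_ae (hβ'.mono fun θ hθ => ?_)
    simp only [tsum_fragment_eq_sum φ hθ hx]

theorem isWeakSolutionBdd_iff (hβ : β {θ : DislocationSpace | 0 < θ.1 k} = 0) {μin : Measure ℝ}
    {μ : ℝ → Measure ℝ} :
    IsWeakSolutionBdd K F β μin μ ↔ μ 0 = μin ∧ (∀ t, 0 ≤ t → μ t (Iic 0) = 0) ∧
      IsGeneratorSolution (posCoag K) (posFrag F) β k μ := by
  have key : (∀ t, 0 ≤ t → μ t (Iic 0) = 0) → ∀ (φ : ℝ → ℝ) (t : ℝ), 0 ≤ t → ∀ d : ℝ,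
      (HasDerivWithinAt (fun s => ∫ x in Ioi (0 : ℝ), φ x ∂(μ s)) d (Ici 0) t ↔
        HasDerivWithinAt (fun s => ∫ x, φ x ∂(μ s)) d (Ici 0) t) := fun hμ φ t ht d =>
    have heq : ∀ s ∈ Ici (0 : ℝ), ∫ x in Ioi (0 : ℝ), φ x ∂(μ s) = ∫ x, φ x ∂(μ s) :=
      fun s hs => by rw [restrict_Ioi_eq_self (hμ s hs)]
    ⟨fun h => h.congr (fun s hs => (heq s hs).symm) (heq t ht).symm,
      fun h => h.congr heq (heq t ht)⟩
  constructor
  · rintro ⟨h1, h2, h3⟩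
    refine ⟨h1, fun t ht => (h2 t ht).2, fun t ht => (h2 t ht).1, fun φ hφ hc t ht => ?_⟩
    rw [← generator_pos_eq hβ (h2 t ht).2, ← key fun t ht => (h2 t ht).2]
    exacts [h3 φ hφ hc t ht, ht]
  · rintro ⟨h1, h2, h3⟩
    refine ⟨h1, fun t ht => ⟨h3.finite t ht, h2 t ht⟩, fun φ hφ hc t ht => ?_⟩
    rw [generator_pos_eq hβ (h2 t ht), key h2]
    exacts [h3.hasDerivWithinAt φ hφ hc t ht, ht]

end Restriction

end CoagFrag

/-- Proposition 3.7: existence and uniqueness of the weak solution of the coagulation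
multi-fragmentation equation for bounded kernels K ≤ K̄, F ≤ F̄ and a finite
dislocation measure β producing at most k fragments, together with the total-mass
bound sup_{s∈[0,t]} ‖μ_s‖ ≤ exp(F̄(k−1)β(Θ)t)·‖μ^in‖. -/
theorem stmt_1 (K : ℝ → ℝ → ℝ) (F : ℝ → ℝ) (β : Measure DislocationSpace)
    (Kbar Fbar : ℝ) (hKbar : 0 < Kbar) (hFbar : 0 < Fbar)
    -- hypotheses on the kernels
    (hKmeas : Measurable (Function.uncurry K))
    (hKsymm : ∀ x y : ℝ, 0 < x → 0 < y → K x y = K y x)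
    (hKnn : ∀ x y : ℝ, 0 < x → 0 < y → 0 ≤ K x y)
    (hKbdd : ∀ x y : ℝ, 0 < x → 0 < y → K x y ≤ Kbar)
    (hFmeas : Measurable F)
    (hFnn : ∀ x : ℝ, 0 < x → 0 ≤ F x)
    (hFbdd : ∀ x : ℝ, 0 < x → F x ≤ Fbar)
    -- hypotheses on the dislocation measure β
    (hβfin : IsFiniteMeasure β)
    (hβmass : β {θ : DislocationSpace | 1 < ∑' k, ENNReal.ofReal (θ.1 k)} = 0)
    (k : ℕ) (hk : 1 ≤ k) (hβfrag : β {θ : DislocationSpace | 0 < θ.1 k} = 0)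
    -- the initial condition
    (μin : Measure ℝ) (hμin_fin : IsFiniteMeasure μin)
    (hμin_supp : μin (Set.Iic 0) = 0) :
    ∃ μ : ℝ → Measure ℝ, IsWeakSolutionBdd K F β μin μ ∧
      (∀ ν : ℝ → Measure ℝ, IsWeakSolutionBdd K F β μin ν →
        ∀ t : ℝ, 0 ≤ t → ν t = μ t) ∧
      ∀ t : ℝ, 0 ≤ t → ∀ s ∈ Set.Icc (0 : ℝ) t,
        μ s Set.univ ≤
          ENNReal.ofReal (Real.exp (Fbar * ((k : ℝ) - 1) * (β Set.univ).toReal * t)) *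
            μin Set.univ := by
  have hK := CoagFrag.isBddKernel_pos hKbar.le hFbar.le hKmeas hKnn hKbdd hFmeas hFnn hFbdd
  obtain ⟨w, hw0, hw, hmass⟩ := hK.exists_isGeneratorSolution (β := β) hk μin
  have hiff := @CoagFrag.isWeakSolutionBdd_iff K F β k hβfrag μin
  have hpos : ∀ t, 0 ≤ t → w t (Set.Iic 0) = 0 := fun t ht =>
    hw.measure_Iic_eq_zero (fun _ _ h => if_neg h) (fun _ h => if_neg h)
      (by rw [hw0, hμin_supp]) ht
  refine ⟨w, hiff.2 ⟨hw0, hpos, hw⟩, fun ν hν t ht => ?_, fun t ht s hs => ?_⟩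
  · obtain ⟨hν0, -, hν'⟩ := hiff.1 hν
    exact hK.generatorSolution_unique hν' hw (hν0.trans hw0.symm) ht
  · have := hw.finite s hs.1
    have hk' : (0 : ℝ) ≤ (k : ℝ) - 1 := by
      rw [sub_nonneg]
      exact_mod_cast hk
    rw [← ofReal_measureReal (μ := w s), ← ofReal_measureReal (μ := μin),
      ← ENNReal.ofReal_mul (Real.exp_pos _).le, mul_comm]
    refine ENNReal.ofReal_le_ofReal ((hmass s hs.1).trans ?_)
    rw [measureReal_def β]
    gcongr
    exact hs.2
end

section
/- For all α > 0 and β > 0 there exists a constant C = C_{α,β} > 0 such that for all x, y ≥ 0: (x^α + y^α)·|x^β − y^β| ≤ 2·|x^{α+β} − y^{α+β}| ≤ C·(x^α + y^α)·|x^β − y^β|. -/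
theorem one_sub_rpow_le_mul_one_sub {p s : ℝ} (hp : 0 < p) (hs : 0 ≤ s) (hs1 : s ≤ 1) :
    1 - s ^ p ≤ (p + 1) * (1 - s) := by
  have h := one_add_mul_self_le_rpow_one_add (s := s - 1) (by linarith)
    (p := p + 1) (by linarith)
  rw [add_sub_cancel] at h
  have h' : s ^ (p + 1) ≤ s ^ p := by
    rw [Real.rpow_add_one' hs (by linarith)]
    exact mul_le_of_le_one_right (Real.rpow_nonneg hs p) hs1
  linarith

theorem rpow_sub_rpow_mul_le {a b x y : ℝ} (ha : 0 < a) (hb : 0 < b) (hx : 0 ≤ x)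
    (hxy : x ≤ y) :
    (y ^ a - x ^ a) * y ^ b ≤ (a / b + 1) * (y ^ a * (y ^ b - x ^ b)) := by
  rcases (hx.trans hxy).eq_or_lt with rfl | hy
  · obtain rfl : x = 0 := le_antisymm hxy hx
    simp
  have ht : 0 ≤ x / y := div_nonneg hx hy.le
  have h := one_sub_rpow_le_mul_one_sub (div_pos ha hb) (Real.rpow_nonneg ht b)
    (Real.rpow_le_one ht ((div_le_one hy).2 hxy) hb.le)
  rw [← Real.rpow_mul ht, mul_div_cancel₀ a hb.ne', Real.div_rpow hx hy.le,
    Real.div_rpow hx hy.le] at h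
  have hya := Real.rpow_pos_of_pos hy a
  have hyb := Real.rpow_pos_of_pos hy b
  calc (y ^ a - x ^ a) * y ^ b = (1 - x ^ a / y ^ a) * (y ^ a * y ^ b) := by field_simp
    _ ≤ (a / b + 1) * (1 - x ^ b / y ^ b) * (y ^ a * y ^ b) := by gcongr
    _ = (a / b + 1) * (y ^ a * (y ^ b - x ^ b)) := by field_simp

theorem rpow_add_sub_rpow_add_bounds_of_le {a b x y : ℝ} (ha : 0 < a) (hb : 0 < b)
    (hx : 0 ≤ x) (hxy : x ≤ y) :
    (x ^ a + y ^ a) * |x ^ b - y ^ b| ≤ 2 * |x ^ (a + b) - y ^ (a + b)| ∧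
      2 * |x ^ (a + b) - y ^ (a + b)| ≤
        (3 + 2 * (a / b)) * (x ^ a + y ^ a) * |x ^ b - y ^ b| := by
  have hy := hx.trans hxy
  have hA := Real.rpow_nonneg hx a
  have hP := Real.rpow_nonneg hx b
  have hAB := Real.rpow_le_rpow hx hxy ha.le
  have hPQ := Real.rpow_le_rpow hx hxy hb.le
  have hS := Real.rpow_le_rpow hx hxy (add_pos ha hb).le
  have key := rpow_sub_rpow_mul_le ha hb hx hxy
  have hK : 0 < a / b := div_pos ha hb
  rw [abs_sub_comm, abs_of_nonneg (sub_nonneg.2 hPQ), abs_sub_comm,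
    abs_of_nonneg (sub_nonneg.2 hS), Real.rpow_add' hx (add_pos ha hb).ne',
    Real.rpow_add' hy (add_pos ha hb).ne']
  have h₁ : 0 ≤ (y ^ a - x ^ a) * (y ^ b + x ^ b) :=
    mul_nonneg (sub_nonneg.2 hAB) (by linarith)
  have h₂ : 0 ≤ (y ^ a - x ^ a) * (y ^ b - x ^ b) :=
    mul_nonneg (sub_nonneg.2 hAB) (sub_nonneg.2 hPQ)
  have h₃ : 0 ≤ (a / b + 1) * (x ^ a * (y ^ b - x ^ b)) :=
    mul_nonneg (by linarith) (mul_nonneg hA (sub_nonneg.2 hPQ))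
  constructor <;> linarith

/-- Elementary inequality (A.2): for α, β > 0 there is C = C_{α,β} > 0 with
(x^α + y^α)|x^β − y^β| ≤ 2|x^{α+β} − y^{α+β}| ≤ C(x^α + y^α)|x^β − y^β| for x, y ≥ 0. -/
theorem stmt_10 (a b : ℝ) (ha : 0 < a) (hb : 0 < b) :
    ∃ C > 0, ∀ x y : ℝ, 0 ≤ x → 0 ≤ y →
      (x ^ a + y ^ a) * |x ^ b - y ^ b| ≤ 2 * |x ^ (a + b) - y ^ (a + b)| ∧
      2 * |x ^ (a + b) - y ^ (a + b)| ≤ C * (x ^ a + y ^ a) * |x ^ b - y ^ b| := by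
  refine ⟨3 + 2 * (a / b), by positivity, fun x y hx hy => ?_⟩
  rcases le_total x y with hxy | hyx
  · exact rpow_add_sub_rpow_add_bounds_of_le ha hb hx hxy
  · rw [add_comm (x ^ a), abs_sub_comm (x ^ b), abs_sub_comm (x ^ (a + b))]
    exact rpow_add_sub_rpow_add_bounds_of_le ha hb hy hyx
end

section
/- Let λ ∈ (0,1], let m = (m_k)_{k≥1} be a nonincreasing sequence of nonnegative reals with ∑_{k≥1} m_k^λ < ∞, and let 1 ≤ i < j. Define m′ by m′_i = m_i + m_j, m′_j = 0 and m′_k = m_k for k ∉ {i,j}, and let c = (c_k)_{k≥1} be a nonincreasing sequence such that c ∘ σ = m′ for some permutation σ of {1,2,3,…}. Then d_λ(c, m) := ∑_{k≥1} |c_k^λ − m_k^λ| ≤ 2 m_j^λ. -/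
open scoped ENNReal

/-- Two nested lower sets of `ℕ` differ by no more elements after permuting the smaller one. -/
theorem encard_sdiff_le_encard_diff_preimage {A B : Set ℕ} (hA : IsLowerSet A) (hAB : A ⊆ B)
    (e : Equiv.Perm ℕ) : (B \ A).encard ≤ (B \ e ⁻¹' A).encard := by
  rcases A.finite_or_infinite with hfin | hinf
  · have hpre : (e ⁻¹' A).encard = A.encard := by
      rw [← e.image_symm_eq_preimage, e.symm.injective.encard_image]
    have h : (B \ A).encard + A.encard ≤ (B \ e ⁻¹' A).encard + A.encard := by
      rw [Set.encard_sdiff_add_encard_of_subset hAB, ← hpre]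
      exact (Set.encard_le_encard (by simp)).trans (Set.encard_union_le _ _)
    exact (ENat.add_le_add_iff_right hfin.encard_lt_top.ne).mp h
  · have hBA : B ⊆ A := fun n _ => by
      obtain ⟨k, hk, hnk⟩ := hinf.exists_gt n
      exact hA hnk.le hk
    simp [Set.sdiff_eq_empty.mpr hBA]

theorem encard_symmDiff_le_encard_symmDiff_preimage {A B : Set ℕ} (hA : IsLowerSet A)
    (hB : IsLowerSet B) (e : Equiv.Perm ℕ) :
    (symmDiff A B).encard ≤ (symmDiff (e ⁻¹' A) B).encard := by
  rcases hA.total hB with h | h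
  · rw [symmDiff_of_le h]
    exact (encard_sdiff_le_encard_diff_preimage hA h e).trans
      (Set.encard_le_encard Set.subset_union_right)
  · rw [symmDiff_of_ge h]
    refine (encard_sdiff_le_encard_diff_preimage hB h e.symm).trans ?_
    have himage : e ⁻¹' (A \ e.symm ⁻¹' B) = e ⁻¹' A \ B := by ext; simp
    rw [← e.symm.injective.encard_image, e.symm.image_eq_preimage_symm, e.symm_symm, himage]
    exact Set.encard_le_encard Set.subset_union_left

theorem tsum_ofReal_abs_sub_eq_lintegral_encard (u v : ℕ → ℝ) :
    ∑' k, ENNReal.ofReal |u k - v k| =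
      ∫⁻ t, ((symmDiff {k | t ≤ u k} {k | t ≤ v k}).encard : ℝ≥0∞) := by
  have hterm (k : ℕ) : ENNReal.ofReal |u k - v k| =
      ∫⁻ t, (Set.uIoc (u k) (v k)).indicator 1 t := by
    rw [MeasureTheory.lintegral_indicator_one measurableSet_uIoc, Real.volume_uIoc, abs_sub_comm]
  simp_rw [hterm]
  rw [← MeasureTheory.lintegral_tsum
    fun k => (measurable_one.indicator measurableSet_uIoc).aemeasurable]
  congr 1 with t
  rw [← ENNReal.tsum_set_one, tsum_subtype _ (fun _ => (1 : ℝ≥0∞))]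
  refine tsum_congr fun k => ?_
  have : t ∈ Set.uIoc (u k) (v k) ↔ k ∈ symmDiff {k | t ≤ u k} {k | t ≤ v k} := by
    simp only [Set.mem_uIoc, Set.mem_symmDiff, Set.mem_ofPred_eq, not_le]
    tauto
  by_cases hk : t ∈ Set.uIoc (u k) (v k)
  · simp [hk, this.mp hk]
  · rw [Set.indicator_of_notMem hk, Set.indicator_of_notMem (this.not.mp hk)]

/-- The `ℓ¹` distance between two sequences is smallest when both are in nonincreasing order. -/
theorem tsum_ofReal_abs_sub_le_comp_perm {u v : ℕ → ℝ} (hu : Antitone u) (hv : Antitone v)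
    (e : Equiv.Perm ℕ) :
    ∑' k, ENNReal.ofReal |u k - v k| ≤ ∑' k, ENNReal.ofReal |u (e k) - v k| := by
  rw [tsum_ofReal_abs_sub_eq_lintegral_encard u v,
    tsum_ofReal_abs_sub_eq_lintegral_encard (fun k => u (e k)) v]
  refine MeasureTheory.lintegral_mono fun t => ?_
  exact ENat.toENNReal_mono <| encard_symmDiff_le_encard_symmDiff_preimage
    (fun _ _ hab ha => le_trans ha (hu hab)) (fun _ _ hab ha => le_trans ha (hv hab)) e

/-- Estimate (C2): d_λ(c_{ij}(m), m) ≤ 2 m_j^λ, where `c` is the nonincreasing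
rearrangement of the sequence obtained from `m` by replacing the i-th entry by
m_i + m_j and the j-th entry by 0 (i < j); the sum defining d_λ is taken in [0,∞]. -/
theorem stmt_13 (lam : ℝ) (hlam : lam ∈ Set.Ioc (0 : ℝ) 1)
    (m : ℕ → ℝ) (hm : Antitone m) (hmnn : ∀ k, 0 ≤ m k)
    (hsum : Summable fun k => m k ^ lam)
    (i j : ℕ) (hij : i < j)
    (c : ℕ → ℝ) (hc_anti : Antitone c) (σ : Equiv.Perm ℕ)
    (hc : ∀ k, c (σ k) = if k = i then m i + m j else if k = j then 0 else m k) :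
    ∑' k, ENNReal.ofReal |c k ^ lam - m k ^ lam| ≤ ENNReal.ofReal (2 * m j ^ lam) := by
  obtain ⟨hpos, hle⟩ := hlam
  have hcnn (k : ℕ) : 0 ≤ c k := by
    obtain ⟨l, rfl⟩ := σ.surjective k
    rw [hc]
    split_ifs
    exacts [add_nonneg (hmnn i) (hmnn j), le_rfl, hmnn l]
  refine (tsum_ofReal_abs_sub_le_comp_perm (u := fun k => c k ^ lam) (v := fun k => m k ^ lam)
    (fun _ b hab => Real.rpow_le_rpow (hcnn b) (hc_anti hab) hpos.le)
    (fun _ b hab => Real.rpow_le_rpow (hmnn b) (hm hab) hpos.le) σ).trans ?_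
  rw [tsum_eq_sum (s := {i, j}), Finset.sum_pair hij.ne]
  · have hj : 0 ≤ m j ^ lam := Real.rpow_nonneg (hmnn j) _
    have hsub : (m i + m j) ^ lam ≤ m i ^ lam + m j ^ lam :=
      Real.rpow_add_le_add_rpow (hmnn i) (hmnn j) hpos.le hle
    have hmono : m i ^ lam ≤ (m i + m j) ^ lam :=
      Real.rpow_le_rpow (hmnn i) (le_add_of_nonneg_right (hmnn j)) hpos.le
    rw [← ENNReal.ofReal_add (abs_nonneg _) (abs_nonneg _)]
    refine ENNReal.ofReal_le_ofReal ?_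
    simp only [hc, if_true, if_neg hij.ne', Real.zero_rpow hpos.ne', zero_sub, abs_neg,
      abs_of_nonneg hj, abs_of_nonneg (sub_nonneg.mpr hmono)]
    linarith
  · intro k hk
    simp only [Finset.mem_insert, Finset.mem_singleton, not_or] at hk
    simp [hc, hk.1, hk.2]
end

section
/- Let λ ∈ (0,1], let m = (m_k)_{k≥1} be a nonincreasing sequence of nonnegative reals with ∑_{k≥1} m_k^λ < ∞, let i ≥ 1, and let θ = (θ_k)_{k≥1} be a sequence of reals with 1 > θ₁ ≥ θ₂ ≥ ⋯ ≥ 0 and ∑_{k≥1} θ_k ≤ 1. Let f = (f_k)_{k≥1} be a nonincreasing sequence of nonnegative reals such that for every t > 0, #{k ≥ 1 : f_k > t} = #{k ≠ i : m_k > t} + #{k ≥ 1 : θ_k m_i > t} (i.e. f is the nonincreasing rearrangement of the family consisting of the m_k for k ≠ i together with the fragments θ_k m_i for k ≥ 1). Then ∑_{k≥1} |f_k^λ − m_k^λ| ≤ m_i^λ (1 − θ₁^λ) + m_i^λ ∑_{k≥2} θ_k^λ (the right-hand side being possibly +∞). -/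
open scoped ENNReal

open MeasureTheory Set in
lemma volume_restrict_Ioi_Ico {a b : ℝ} (ha : 0 ≤ a) :
    volume.restrict (Ioi (0 : ℝ)) (Ico a b) = ENNReal.ofReal (b - a) := by
  rw [Measure.restrict_congr_set Ioi_ae_eq_Ici, Measure.restrict_apply measurableSet_Ico,
    inter_eq_left.2 (Ico_subset_Ici_self.trans (Ici_subset_Ici.2 ha)), Real.volume_Ico]

lemma tsum_indicator_one_eq_encard {α : Type*} (s : Set α) :
    ∑' k, s.indicator (1 : α → ℝ≥0∞) k = (s.encard : ℝ≥0∞) := by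
  rw [← ENNReal.tsum_set_one, tsum_subtype s (fun _ => (1 : ℝ≥0∞))]
  rfl

/-- The symmetric difference of two nested sets `A` and `B`, when `A` arises from the finite set `B`
(up to cardinality) by removing a point `i` and adding a set that is an initial segment of `ℕ`. -/
lemma encard_symmDiff_le_of_fragmentation {A B C : Set ℕ} {i : ℕ}
    (hA : IsLowerSet A) (hB : IsLowerSet B) (hC : IsLowerSet C)
    (hBfin : B.Finite) (hCB : C.Nonempty → i ∈ B)
    (hcard : A.encard = (B \ {i}).encard + C.encard) :
    (symmDiff A B).encard ≤
      {j : ℕ | j = 0 ∧ i ∈ B ∧ 0 ∉ C}.encard + {k | k + 1 ∈ C}.encard := by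
  by_cases hi : i ∈ B
  swap
  · have hCe : C = ∅ := by
      by_contra h
      exact hi (hCB (Set.nonempty_iff_ne_empty.2 h))
    rw [Set.sdiff_singleton_eq_self hi, hCe, Set.encard_empty, add_zero] at hcard
    have hAfin : A.Finite := by
      rw [← Set.encard_lt_top_iff, hcard]; exact hBfin.encard_lt_top
    have : A = B := by
      rcases hA.total hB with h | h
      · exact hAfin.eq_of_subset_of_encard_le h hcard.ge
      · exact (hBfin.eq_of_subset_of_encard_le h hcard.le).symm
    simp [this]
  have hBi := Set.encard_sdiff_singleton_add_one hi
  by_cases h0 : 0 ∈ C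
  · have hC1 : C.encard = {k | k + 1 ∈ C}.encard + 1 := by
      rw [← Set.encard_sdiff_singleton_add_one h0]
      congr 1
      rw [← (add_left_injective 1).encard_image {k | k + 1 ∈ C}]
      congr 1
      ext k
      cases k <;> simp
    have hAB : A.encard = B.encard + {k | k + 1 ∈ C}.encard := by
      rw [hcard, hC1, ← hBi]; ring
    have hsub : B ⊆ A := by
      rcases hA.total hB with h | h
      · exact (hBfin.eq_of_subset_of_encard_le' h (hAB ▸ le_self_add)).ge
      · exact h
    rw [symmDiff_of_ge hsub]
    refine le_add_left (le_of_eq ?_)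
    rw [← Set.encard_sdiff_add_encard_of_subset hsub, add_comm] at hAB
    exact ENat.add_right_injective_of_ne_top hBfin.encard_lt_top.ne hAB
  · have hCe : C = ∅ := by
      by_contra h
      obtain ⟨k, hk⟩ := Set.nonempty_iff_ne_empty.2 h
      exact h0 (hC (Nat.zero_le k) hk)
    rw [hCe, Set.encard_empty, add_zero] at hcard
    have hAB : A.encard + 1 = B.encard := by rw [hcard, hBi]
    have hAfin : A.Finite := by
      rw [← Set.encard_lt_top_iff]
      exact lt_of_le_of_lt (hAB ▸ le_self_add) hBfin.encard_lt_top
    have hsub : A ⊆ B := by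
      rcases hA.total hB with h | h
      · exact h
      · exact (hAfin.eq_of_subset_of_encard_le' h (hAB ▸ le_self_add)).ge
    rw [symmDiff_of_le hsub]
    refine le_add_right (le_of_eq ?_)
    have hBA := Set.encard_sdiff_add_encard_of_subset hsub
    rw [← hAB, add_comm] at hBA
    rw [ENat.add_right_injective_of_ne_top hAfin.encard_lt_top.ne hBA]
    simp [hi, hCe]

open MeasureTheory Set in
lemma ofReal_abs_sub_eq_lintegral {a b : ℝ} (ha : 0 ≤ a) (hb : 0 ≤ b) :
    ENNReal.ofReal |a - b| =
      ∫⁻ s in Ioi (0 : ℝ), (Ico (min a b) (max a b)).indicator 1 s := by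
  rw [lintegral_indicator_one measurableSet_Ico, volume_restrict_Ioi_Ico (le_min ha hb),
    max_sub_min_eq_abs']

open MeasureTheory Set in
/-- If a nonincreasing sequence `F` is the rearrangement of the family obtained from `M` by
replacing `M i` with fragments `C k ≤ M i`, its `ℓ¹` distance to `M` is at most the loss
`M i - C 0` plus the total size of the other fragments. -/
lemma tsum_abs_sub_le_of_fragmentation {F M C : ℕ → ℝ} {i : ℕ}
    (hF : Antitone F) (hM : Antitone M) (hC : Antitone C)
    (hF0 : ∀ k, 0 ≤ F k) (hM0 : ∀ k, 0 ≤ M k) (hC0 : ∀ k, 0 ≤ C k)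
    (hsum : Summable M) (hCM : C 0 ≤ M i)
    (hcard : ∀ s : ℝ, 0 < s → {k | s < F k}.encard =
      {k | k ≠ i ∧ s < M k}.encard + {k | s < C k}.encard) :
    ∑' k, ENNReal.ofReal |F k - M k| ≤
      ENNReal.ofReal (M i - C 0) + ∑' k, ENNReal.ofReal (C (k + 1)) := by
  have hrhs : ENNReal.ofReal (M i - C 0) + ∑' k, ENNReal.ofReal (C (k + 1)) =
      ∫⁻ s in Ioi (0 : ℝ), ((Ico (C 0) (M i)).indicator 1 s +
        ∑' k, (Ico 0 (C (k + 1))).indicator 1 s) := by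
    rw [lintegral_add_left (measurable_one.indicator measurableSet_Ico),
      lintegral_tsum fun k => (measurable_one.indicator measurableSet_Ico).aemeasurable,
      lintegral_indicator_one measurableSet_Ico, volume_restrict_Ioi_Ico (hC0 0)]
    congr 2
    ext k
    rw [lintegral_indicator_one measurableSet_Ico, volume_restrict_Ioi_Ico le_rfl, sub_zero]
  rw [hrhs]
  rw [tsum_congr fun k => ofReal_abs_sub_eq_lintegral (hF0 k) (hM0 k)]
  rw [← lintegral_tsum fun k => (measurable_one.indicator measurableSet_Ico).aemeasurable]
  refine setLIntegral_mono' measurableSet_Ioi fun s (hs : 0 < s) => ?_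
  have hfin : {k | s < M k}.Finite := by
    have h := hsum.tendsto_cofinite_zero.eventually (gt_mem_nhds hs)
    exact h.subset fun k hk => (not_lt_of_gt hk : ¬ M k < s)
  have key := encard_symmDiff_le_of_fragmentation (A := {k | s < F k}) (B := {k | s < M k})
    (C := {k | s < C k}) (i := i)
    (fun a b hab h => lt_of_lt_of_le h (hF hab)) (fun a b hab h => lt_of_lt_of_le h (hM hab))
    (fun a b hab h => lt_of_lt_of_le h (hC hab)) hfin
    (fun ⟨k, hk⟩ => lt_of_lt_of_le hk ((hC (Nat.zero_le k)).trans hCM))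
    (by rw [hcard s hs]; congr 2; ext k; simp [and_comm])
  have key' := ENat.toENNReal_le.2 key
  rw [ENat.toENNReal_add] at key'
  simp only [← tsum_indicator_one_eq_encard] at key'
  convert key' using 1
  · congr 1; ext k
    simp only [indicator, mem_Ico, min_le_iff, lt_max_iff, mem_symmDiff, mem_ofPred_eq,
      Pi.one_apply]
    congr 1
    grind
  · congr 1
    · rw [tsum_eq_single 0 fun k hk => by simp [hk]]
      simp [indicator, and_comm]
    · congr 1; ext k
      simp [indicator, hs.le]

/-- Estimate (F2): d_λ(f_{iθ}(m), m) ≤ m_i^λ(1 − θ₁^λ) + m_i^λ ∑_{k≥2} θ_k^λ.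
Here `f` is the nonincreasing rearrangement of the family consisting of the entries
m_k for k ≠ i together with the fragments θ_k·m_i (sequences and θ indexed from 0,
`θ 0` being θ₁); the rearrangement is encoded by equality of the extended cardinals
of the super-level sets, and the sums are taken in [0,∞]. -/
theorem stmt_15 (lam : ℝ) (hlam : lam ∈ Set.Ioc (0 : ℝ) 1)
    (m : ℕ → ℝ) (hm : Antitone m) (hmnn : ∀ k, 0 ≤ m k)
    (hsum : Summable fun k => m k ^ lam)
    (i : ℕ)
    (θ : ℕ → ℝ) (hθ1 : θ 0 < 1) (hθanti : Antitone θ) (hθnn : ∀ k, 0 ≤ θ k)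
    (hθsum : ∑' k, ENNReal.ofReal (θ k) ≤ 1)
    (f : ℕ → ℝ) (hf_anti : Antitone f) (hfnn : ∀ k, 0 ≤ f k)
    (hf : ∀ t : ℝ, 0 < t →
      {k | t < f k}.encard =
        {k | k ≠ i ∧ t < m k}.encard + {k | t < θ k * m i}.encard) :
    ∑' k, ENNReal.ofReal |f k ^ lam - m k ^ lam| ≤
      ENNReal.ofReal (m i ^ lam * (1 - θ 0 ^ lam)) +
        ENNReal.ofReal (m i ^ lam) * ∑' k, ENNReal.ofReal (θ (k + 1) ^ lam) := by
  have hl : 0 < lam := hlam.1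
  have hcnn : ∀ k, 0 ≤ θ k * m i := fun k => mul_nonneg (hθnn k) (hmnn i)
  have hpow : ∀ {x y : ℝ}, 0 ≤ x → x ≤ y → x ^ lam ≤ y ^ lam :=
    fun hx hxy => Real.rpow_le_rpow hx hxy hl.le
  have hlt : ∀ {s x : ℝ}, 0 < s → 0 ≤ x → (s < x ^ lam ↔ s ^ lam⁻¹ < x) :=
    fun hs hx => (Real.rpow_inv_lt_iff_of_pos hs.le hx hl).symm
  have h := tsum_abs_sub_le_of_fragmentation (F := fun k => f k ^ lam) (M := fun k => m k ^ lam)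
    (C := fun k => (θ k * m i) ^ lam) (i := i)
    (fun a b hab => hpow (hfnn b) (hf_anti hab)) (fun a b hab => hpow (hmnn b) (hm hab))
    (fun a b hab => hpow (hcnn b) (mul_le_mul_of_nonneg_right (hθanti hab) (hmnn i)))
    (fun k => Real.rpow_nonneg (hfnn k) _) (fun k => Real.rpow_nonneg (hmnn k) _)
    (fun k => Real.rpow_nonneg (hcnn k) _) hsum
    (hpow (hcnn 0) (mul_le_of_le_one_left (hmnn i) hθ1.le))
    (fun s hs => by
      simp only [hlt hs (hfnn _), hlt hs (hmnn _), hlt hs (hcnn _)]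
      exact hf _ (Real.rpow_pos_of_pos hs _))
  refine h.trans (le_of_eq ?_)
  rw [← ENNReal.tsum_mul_left]
  congr 1
  · rw [Real.mul_rpow (hθnn 0) (hmnn i)]
    congr 1; ring
  · congr 1; ext k
    rw [Real.mul_rpow (hθnn _) (hmnn i), mul_comm, ENNReal.ofReal_mul (Real.rpow_nonneg (hmnn i) _)]
end

section
/- Let λ ∈ (0,1], let m = (m_k)_{k≥1} be a nonincreasing sequence of nonnegative reals with ∑_{k≥1} m_k^λ < ∞, let i ≥ 1, let θ = (θ_k)_{k≥1} be a sequence of reals with 1 > θ₁ ≥ θ₂ ≥ ⋯ ≥ 0 and ∑_{k≥1} θ_k ≤ 1, and let 1 ≤ u < v. For n ≥ 1 write ψ_n(θ) := (θ₁,…,θ_n,0,0,…), and let f^u and f^v be the nonincreasing rearrangements of the families {m_k : k ≠ i} ∪ {[ψ_u(θ)]_k m_i : k ≥ 1} and {m_k : k ≠ i} ∪ {[ψ_v(θ)]_k m_i : k ≥ 1} respectively. Then ∑_{k≥1} |(f^u_k)^λ − (f^v_k)^λ| ≤ m_i^λ ∑_{k=u+1}^{v} θ_k^λ. -/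
open scoped ENNReal

open MeasureTheory

/-- An antitone sequence with smaller super-level counts is pointwise smaller. -/
theorem le_of_encard_superlevel_le {f g : ℕ → ℝ} (hf : Antitone f) (hg : Antitone g)
    (hg0 : ∀ k, 0 ≤ g k)
    (h : ∀ t : ℝ, 0 < t → {k | t < f k}.encard ≤ {k | t < g k}.encard) (k : ℕ) :
    f k ≤ g k := by
  by_contra! hlt
  obtain ⟨t, hgt, htf⟩ := exists_between hlt
  have h1 : ((Finset.range (k + 1) : Finset ℕ) : Set ℕ) ⊆ {j | t < f j} := by
    intro j hj
    have hj' : j ≤ k := by simpa [Nat.lt_succ_iff] using hj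
    exact htf.trans_le (hf hj')
  have h2 : {j | t < g j} ⊆ ((Finset.range k : Finset ℕ) : Set ℕ) := by
    intro j (hj : t < g j)
    by_contra hjk
    have hjk' : k ≤ j := by simpa using hjk
    exact absurd (hg hjk') (not_le.2 (hgt.trans hj))
  have h3 := (Set.encard_le_encard h1).trans
    ((h t ((hg0 k).trans_lt hgt)).trans (Set.encard_le_encard h2))
  rw [Set.encard_coe_eq_coe_finsetCard, Set.encard_coe_eq_coe_finsetCard] at h3
  simp only [Finset.card_range, Nat.cast_le] at h3
  omega

/-- The total length of a countable family of intervals is the integral of the number of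
intervals covering a point. -/
theorem tsum_ofReal_sub_eq_lintegral_encard {ι : Type*} [Countable ι] (a b : ι → ℝ) :
    ∑' k, ENNReal.ofReal (b k - a k) =
      ∫⁻ s : ℝ, ({k | a k ≤ s ∧ s < b k}.encard : ℝ≥0∞) := by
  simp_rw [← Real.volume_Ico, ← lintegral_indicator_one measurableSet_Ico]
  rw [← lintegral_tsum fun k => (measurable_one.indicator measurableSet_Ico).aemeasurable]
  refine lintegral_congr fun s => ?_
  rw [← ENNReal.tsum_set_one, tsum_subtype {k | a k ≤ s ∧ s < b k} fun _ => (1 : ℝ≥0∞)]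
  rfl

/-- Layer-cake comparison: if, for almost every level, at most as many of the intervals
`[a k, b k)` as of the intervals `[c k, d k)` contain it, then the total length of the former is
at most that of the latter. -/
theorem tsum_ofReal_sub_le_of_encard_le {ι κ : Type*} [Countable ι] [Countable κ]
    {a b : ι → ℝ} {c d : κ → ℝ}
    (h : ∀ᵐ s : ℝ, {k | a k ≤ s ∧ s < b k}.encard ≤ {k | c k ≤ s ∧ s < d k}.encard) :
    ∑' k, ENNReal.ofReal (b k - a k) ≤ ∑' k, ENNReal.ofReal (d k - c k) := by
  rw [tsum_ofReal_sub_eq_lintegral_encard, tsum_ofReal_sub_eq_lintegral_encard]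
  refine lintegral_mono_ae (h.mono fun s hs => ?_)
  exact_mod_cast hs

/-- The super-level set of a truncated scaled sequence at a positive level. -/
theorem setOf_lt_truncation_mul {t : ℝ} (ht : 0 < t) (θ : ℕ → ℝ) (c : ℝ) (n : ℕ) :
    {k | t < (if k < n then θ k else 0) * c} = {k | k < n ∧ t < θ k * c} := by
  ext k
  by_cases hk : k < n <;> simp [hk, ht.le]

/-- Estimate (dln): for the truncations ψ_n(θ) = (θ₁,…,θ_n,0,…) and 1 ≤ u < v,
d_λ(f_{iψ_u(θ)}(m), f_{iψ_v(θ)}(m)) ≤ m_i^λ ∑_{k=u+1}^{v} θ_k^λ. Sequences and θ are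
indexed from 0 (`θ 0` is θ₁, so ψ_n keeps the indices k < n and the 1-based range
u+1,…,v corresponds to `Finset.Ico u v`); rearrangements are encoded via extended
cardinals of super-level sets and the sum defining d_λ is taken in [0,∞]. -/
theorem stmt_17 (lam : ℝ) (hlam : lam ∈ Set.Ioc (0 : ℝ) 1)
    (m : ℕ → ℝ) (hm : Antitone m) (hmnn : ∀ k, 0 ≤ m k)
    (hsum : Summable fun k => m k ^ lam)
    (i : ℕ)
    (θ : ℕ → ℝ) (hθ1 : θ 0 < 1) (hθanti : Antitone θ) (hθnn : ∀ k, 0 ≤ θ k)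
    (hθsum : ∑' k, ENNReal.ofReal (θ k) ≤ 1)
    (u v : ℕ) (hu : 1 ≤ u) (huv : u < v)
    (fu : ℕ → ℝ) (hfu_anti : Antitone fu) (hfunn : ∀ k, 0 ≤ fu k)
    (hfu : ∀ t : ℝ, 0 < t →
      {k | t < fu k}.encard =
        {k | k ≠ i ∧ t < m k}.encard +
          {k | t < (if k < u then θ k else 0) * m i}.encard)
    (fv : ℕ → ℝ) (hfv_anti : Antitone fv) (hfvnn : ∀ k, 0 ≤ fv k)
    (hfv : ∀ t : ℝ, 0 < t →
      {k | t < fv k}.encard =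
        {k | k ≠ i ∧ t < m k}.encard +
          {k | t < (if k < v then θ k else 0) * m i}.encard) :
    ∑' k, ENNReal.ofReal |fu k ^ lam - fv k ^ lam| ≤
      ENNReal.ofReal (m i ^ lam * ∑ k ∈ Finset.Ico u v, θ k ^ lam) := by
  obtain ⟨hl0, -⟩ := hlam
  have hfin : ∀ t : ℝ, 0 < t → {k | k ≠ i ∧ t < m k}.encard ≠ ⊤ := by
    intro t ht
    have htl : 0 < t ^ lam := Real.rpow_pos_of_pos ht lam
    have hev := hsum.tendsto_cofinite_zero.eventually_lt_const htl
    rw [Set.encard_ne_top_iff]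
    refine (Filter.eventually_cofinite.1 hev).subset ?_
    rintro k ⟨-, hk⟩
    exact not_lt.2 (Real.rpow_le_rpow ht.le hk.le hl0.le)
  have hcount : ∀ t : ℝ, 0 < t → {k | t < fv k}.encard =
      {k | t < fu k}.encard + {k | (u ≤ k ∧ k < v) ∧ t < θ k * m i}.encard := by
    intro t ht
    rw [hfu t ht, hfv t ht, add_assoc, setOf_lt_truncation_mul ht, setOf_lt_truncation_mul ht]
    congr 1
    rw [← Set.encard_union_eq]
    · congr 1
      ext k
      simp only [Set.mem_ofPred_eq, Set.mem_union]
      constructor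
      · rintro ⟨hk, hkt⟩
        rcases lt_or_ge k u with h | h
        · exact Or.inl ⟨h, hkt⟩
        · exact Or.inr ⟨⟨h, hk⟩, hkt⟩
      · rintro (⟨hk, hkt⟩ | ⟨⟨-, hk⟩, hkt⟩)
        · exact ⟨hk.trans huv, hkt⟩
        · exact ⟨hk, hkt⟩
    · rw [Set.disjoint_left]
      rintro k ⟨hk, -⟩ ⟨⟨hk', -⟩, -⟩
      omega
  have hfinu : ∀ t : ℝ, 0 < t → {k | t < fu k}.encard ≠ ⊤ := by
    intro t ht
    rw [hfu t ht, setOf_lt_truncation_mul ht]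
    refine WithTop.add_ne_top.2 ⟨hfin t ht, Set.encard_ne_top_iff.2 ?_⟩
    exact (Set.finite_lt_nat u).subset fun k hk => hk.1
  have hle : ∀ k, fu k ≤ fv k :=
    le_of_encard_superlevel_le hfu_anti hfv_anti hfvnn fun t ht => by
      rw [hcount t ht]
      exact le_self_add
  have hdiff : ∀ t : ℝ, 0 < t → {k | fu k ≤ t ∧ t < fv k}.encard =
      {k | (u ≤ k ∧ k < v) ∧ t < θ k * m i}.encard := by
    intro t ht
    have hsub : {k | t < fu k} ⊆ {k | t < fv k} := fun k hk => lt_of_lt_of_le hk (hle k)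
    have hd := Set.encard_sdiff_add_encard_of_subset hsub
    rw [hcount t ht, add_comm] at hd
    have hset : {k | t < fv k} \ {k | t < fu k} = {k | fu k ≤ t ∧ t < fv k} := by
      ext k
      simp [and_comm]
    rw [hset] at hd
    exact ENat.add_right_injective_of_ne_top (hfinu t ht) hd
  have hlevel : ∀ {s x : ℝ}, 0 < s → 0 ≤ x → (s < x ^ lam ↔ s ^ lam⁻¹ < x) := fun hs hx =>
    (Real.rpow_inv_lt_iff_of_pos hs.le hx hl0).symm
  have hθm : ∀ k, 0 ≤ θ k * m i := fun k => mul_nonneg (hθnn k) (hmnn i)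
  have hmain : ∑' k, ENNReal.ofReal (fv k ^ lam - fu k ^ lam) ≤
      ∑' k : ℕ, ENNReal.ofReal ((if u ≤ k ∧ k < v then (θ k * m i) ^ lam else 0) - 0) := by
    refine tsum_ofReal_sub_le_of_encard_le ?_
    filter_upwards [Measure.ae_ne volume (0 : ℝ)] with s hs0
    rcases lt_or_gt_of_ne hs0 with hs | hs
    · have hempty : {k | fu k ^ lam ≤ s ∧ s < fv k ^ lam} = ∅ := by
        ext k
        simp only [Set.mem_ofPred_eq, Set.mem_empty_iff_false, iff_false, not_and]
        intro h
        exact absurd (Real.rpow_nonneg (hfunn k) lam) (not_le.2 (h.trans_lt hs))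
      simp [hempty]
    · have ht : 0 < s ^ lam⁻¹ := Real.rpow_pos_of_pos hs _
      have h1 : {k | fu k ^ lam ≤ s ∧ s < fv k ^ lam} =
          {k | fu k ≤ s ^ lam⁻¹ ∧ s ^ lam⁻¹ < fv k} := by
        ext k
        simp only [Set.mem_ofPred_eq]
        rw [hlevel hs (hfvnn k), ← not_lt, hlevel hs (hfunn k), not_lt]
      rw [h1, hdiff _ ht]
      refine Set.encard_le_encard ?_
      rintro k ⟨hk, hkt⟩
      refine ⟨hs.le, ?_⟩
      rw [if_pos hk]
      exact (hlevel hs (hθm k)).2 hkt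
  have habs : ∀ k, |fu k ^ lam - fv k ^ lam| = fv k ^ lam - fu k ^ lam := fun k => by
    rw [abs_sub_comm]
    exact abs_of_nonneg (sub_nonneg.2 (Real.rpow_le_rpow (hfunn k) (hle k) hl0.le))
  simp_rw [habs]
  refine hmain.trans_eq ?_
  rw [tsum_eq_sum (s := Finset.Ico u v) fun k hk => by
      rw [Finset.mem_Ico] at hk
      simp [hk],
    Finset.mul_sum, ENNReal.ofReal_sum_of_nonneg fun k _ =>
      mul_nonneg (Real.rpow_nonneg (hmnn i) _) (Real.rpow_nonneg (hθnn k) _)]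
  refine Finset.sum_congr rfl fun k hk => ?_
  rw [if_pos (Finset.mem_Ico.1 hk), sub_zero, Real.mul_rpow (hθnn k) (hmnn i), mul_comm]
end

section
/- Let λ ∈ (0,1]. There exists a constant C > 0 depending only on λ such that for all nonincreasing sequences m = (m_k)_{k≥1} and m̃ = (m̃_k)_{k≥1} of nonnegative reals with ‖m‖₁ := ∑_{k≥1} m_k < ∞ and ‖m̃‖₁ < ∞: ∑_{k≥1} 2^{−k}|m_k − m̃_k| ≤ C · max(‖m‖₁^{1−λ}, ‖m̃‖₁^{1−λ}) · ∑_{k≥1} |m_k^λ − m̃_k^λ|. -/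
open scoped ENNReal

/-- For `0 ≤ b ≤ a`, weighted AM-GM controls `a - b` by the difference of the `p`-th powers. -/
lemma mul_sub_le_rpow_mul_rpow_sub_rpow {p a b : ℝ} (hp : 0 < p) (hp1 : p ≤ 1) (hb : 0 ≤ b)
    (hba : b ≤ a) : p * (a - b) ≤ a ^ (1 - p) * (a ^ p - b ^ p) := by
  have ha : 0 ≤ a := hb.trans hba
  have hamgm := Real.geom_mean_le_arith_mean2_weighted (sub_nonneg.2 hp1) hp.le ha hb
    (sub_add_cancel 1 p)
  have hmul : a ^ (1 - p) * a ^ p = a := by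
    rw [← Real.rpow_add' ha (by simp), sub_add_cancel, Real.rpow_one]
  rw [mul_sub (a ^ (1 - p)), hmul]
  linarith

/-- The symmetric form, with upper bounds `A` and `B` for `a` and `b`. -/
lemma abs_sub_le_inv_mul_max_mul_abs_rpow_sub_rpow {p a b A B : ℝ} (hp : 0 < p) (hp1 : p ≤ 1)
    (ha : 0 ≤ a) (hb : 0 ≤ b) (haA : a ≤ A) (hbB : b ≤ B) :
    |a - b| ≤ p⁻¹ * max (A ^ (1 - p)) (B ^ (1 - p)) * |a ^ p - b ^ p| := by
  wlog hba : b ≤ a generalizing a b A B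
  · rw [abs_sub_comm a, abs_sub_comm (a ^ p), max_comm]
    exact this hb ha hbB haA (le_of_not_ge hba)
  have hpow : 0 ≤ a ^ p - b ^ p := sub_nonneg.2 (Real.rpow_le_rpow hb hba hp.le)
  rw [abs_of_nonneg (sub_nonneg.2 hba), abs_of_nonneg hpow, mul_assoc, le_inv_mul_iff₀ hp]
  refine (mul_sub_le_rpow_mul_rpow_sub_rpow hp hp1 hb hba).trans ?_
  gcongr
  exact (Real.rpow_le_rpow ha haA (sub_nonneg.2 hp1)).trans (le_max_left _ _)

/-- Inequality (d_dlambda): there is C = C(λ) > 0 such that for all nonincreasing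
summable nonnegative sequences m, m̃, d(m,m̃) ≤ C max(‖m‖₁^{1−λ}, ‖m̃‖₁^{1−λ}) d_λ(m,m̃).
Sequences are indexed from 0 (so the weight of index k in d is 2^{−(k+1)});
the sums defining d and d_λ are taken in [0,∞]. -/
theorem stmt_18 (lam : ℝ) (hlam : lam ∈ Set.Ioc (0 : ℝ) 1) :
    ∃ C > (0 : ℝ), ∀ m mt : ℕ → ℝ, Antitone m → Antitone mt →
      (∀ k, 0 ≤ m k) → (∀ k, 0 ≤ mt k) → Summable m → Summable mt →
      ∑' k : ℕ, ENNReal.ofReal ((2 : ℝ)⁻¹ ^ (k + 1) * |m k - mt k|) ≤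
        ENNReal.ofReal
            (C * max ((∑' k, m k) ^ (1 - lam)) ((∑' k, mt k) ^ (1 - lam))) *
          ∑' k : ℕ, ENNReal.ofReal |m k ^ lam - mt k ^ lam| := by
  obtain ⟨hpos, hle⟩ := hlam
  refine ⟨lam⁻¹, inv_pos.2 hpos, fun m mt _ _ hm hmt hsm hsmt => ?_⟩
  rw [← ENNReal.tsum_mul_left]
  refine ENNReal.tsum_le_tsum fun k => ?_
  have hmax : 0 ≤ max ((∑' k, m k) ^ (1 - lam)) ((∑' k, mt k) ^ (1 - lam)) :=
    le_max_of_le_left (Real.rpow_nonneg (tsum_nonneg hm) _)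
  rw [← ENNReal.ofReal_mul (mul_nonneg (inv_pos.2 hpos).le hmax)]
  refine ENNReal.ofReal_le_ofReal ?_
  calc (2 : ℝ)⁻¹ ^ (k + 1) * |m k - mt k| ≤ |m k - mt k| :=
        mul_le_of_le_one_left (abs_nonneg _) (pow_le_one₀ (by norm_num) (by norm_num))
    _ ≤ _ := abs_sub_le_inv_mul_max_mul_abs_rpow_sub_rpow hpos hle (hm k) (hmt k)
        (hsm.le_tsum k fun j _ => hm j) (hsmt.le_tsum k fun j _ => hmt j)
end

section
/- Let m = (m_k)_{k≥1} be a nonincreasing sequence of nonnegative reals with ∑_{k≥1} m_k < ∞, let i ≥ 1, and let θ = (θ_k)_{k≥1} be a sequence of reals with 1 > θ₁ ≥ θ₂ ≥ ⋯ ≥ 0 and ∑_{k≥1} θ_k ≤ 1. Let f = (f_k)_{k≥1} be a nonincreasing sequence of nonnegative reals such that for every t > 0, #{k ≥ 1 : f_k > t} = #{k ≠ i : m_k > t} + #{k ≥ 1 : θ_k m_i > t}. Then ∑_{k≥1} 2^{−k}|f_k − m_k| ≤ 2(1 − θ₁)·2^{−i}·m_i. -/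
open MeasureTheory

/-- The distance of two reals is the length of the interval between them. -/
theorem volume_Ioo_min_max (a b : ℝ) :
    volume (Set.Ioo (min a b) (max a b)) = ENNReal.ofReal |a - b| := by
  rw [Real.volume_Ioo, max_sub_min_eq_abs']

theorem tsum_indicator_one_eq_encard_s19 {α β : Type*} (s : α → Set β) (t : β) :
    ∑' k, (s k).indicator (fun _ => (1 : ENNReal)) t = ({k | t ∈ s k}.encard : ENNReal) := by
  classical
  rw [← ENNReal.tsum_set_one, tsum_subtype {k | t ∈ s k} (fun _ => (1 : ENNReal))]
  refine tsum_congr fun k => ?_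
  simp [Set.indicator_apply]

theorem encard_succ_set (P : ℕ → Prop) [DecidablePred P] :
    {k | P k}.encard = (if P 0 then 1 else 0) + {k | P (k + 1)}.encard := by
  have h1 : {k | P k} = {k | k = 0 ∧ P 0} ∪ (fun k => k + 1) '' {k | P (k + 1)} := by
    ext k
    cases k <;> simp
  rw [h1, Set.encard_union_eq, Function.Injective.encard_image (add_left_injective 1)]
  · congr 1
    split_ifs with h <;> simp [h]
  · rw [Set.disjoint_left]
    rintro k ⟨rfl, -⟩ ⟨j, -, hj⟩
    simp at hj

theorem encard_setOf_eq_add_ne (P : ℕ → Prop) [DecidablePred P] (i : ℕ) :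
    {k | P k}.encard = {k | k ≠ i ∧ P k}.encard + (if P i then 1 else 0) := by
  have h1 : {k | P k} = {k | k ≠ i ∧ P k} ∪ {k | k = i ∧ P i} := by
    ext k
    by_cases h : k = i <;> simp [h]
  conv_lhs => rw [h1]
  rw [Set.encard_union_eq]
  · congr 1
    split_ifs with h <;> simp [h]
  · rw [Set.disjoint_left]
    rintro k ⟨h, -⟩ ⟨h', -⟩
    exact h h'

section Fragmentation

variable {m θ f : ℕ → ℝ} {i : ℕ}

/-- Replacing the `i`-th particle by smaller fragments leaves the larger particles in place. -/
theorem rearrangement_eq_of_lt (hm : Antitone m) (hmnn : ∀ k, 0 ≤ m k)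
    (hθ : ∀ k, θ k ≤ 1) (hf_anti : Antitone f) (hfnn : ∀ k, 0 ≤ f k)
    (hf : ∀ t : ℝ, 0 < t →
      {k | t < f k}.encard =
        {k | k ≠ i ∧ t < m k}.encard + {k | t < θ k * m i}.encard)
    {k : ℕ} (hk : k < i) : f k = m k := by
  have card_Iio : (Set.Iio k).encard = k := by
    rw [← Finset.coe_Iio, Set.encard_coe_eq_coe_finsetCard]; simp
  have card_Iic : (Set.Iic k).encard = k + 1 := by
    rw [← Finset.coe_Iic, Set.encard_coe_eq_coe_finsetCard]; simp
  have succ_not_le : ¬ ((k : ℕ∞) + 1 ≤ k) := by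
    intro h
    have : k + 1 ≤ k := by exact_mod_cast h
    omega
  rcases lt_trichotomy (f k) (m k) with h | h | h
  · obtain ⟨t, ht1, ht2⟩ := exists_between h
    have ht0 := (hfnn k).trans_lt ht1
    have hA : {j | t < f j} ⊆ Set.Iio k := fun j hj => by
      by_contra hjk
      exact absurd (hf_anti (not_lt.1 hjk)) (not_le.2 (ht1.trans hj))
    have hB : Set.Iic k ⊆ {j | j ≠ i ∧ t < m j} := fun j hj =>
      ⟨(lt_of_le_of_lt hj hk).ne, ht2.trans_le (hm hj)⟩
    refine (succ_not_le ?_).elim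
    calc (k : ℕ∞) + 1 = (Set.Iic k).encard := card_Iic.symm
      _ ≤ {j | j ≠ i ∧ t < m j}.encard := Set.encard_le_encard hB
      _ ≤ {j | t < f j}.encard := by rw [hf t ht0]; exact le_self_add
      _ ≤ (Set.Iio k).encard := Set.encard_le_encard hA
      _ = k := card_Iio
  · exact h
  · obtain ⟨t, ht1, ht2⟩ := exists_between h
    have ht0 := (hmnn k).trans_lt ht1
    have hA : Set.Iic k ⊆ {j | t < f j} := fun j hj => ht2.trans_le (hf_anti hj)
    have hB : {j | j ≠ i ∧ t < m j} ⊆ Set.Iio k := fun j hj => by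
      by_contra hjk
      exact absurd (hm (not_lt.1 hjk)) (not_le.2 (ht1.trans hj.2))
    have hC : {j | t < θ j * m i} = ∅ := by
      ext j
      have h1 : θ j * m i ≤ m i := mul_le_of_le_one_left (hmnn i) (hθ j)
      have h2 := hm hk.le
      simp only [Set.mem_ofPred_eq, Set.mem_empty_iff_false, iff_false, not_lt]
      linarith
    refine (succ_not_le ?_).elim
    calc (k : ℕ∞) + 1 = (Set.Iic k).encard := card_Iic.symm
      _ ≤ {j | t < f j}.encard := Set.encard_le_encard hA
      _ = {j | j ≠ i ∧ t < m j}.encard := by rw [hf t ht0, hC]; simp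
      _ ≤ (Set.Iio k).encard := Set.encard_le_encard hB
      _ = k := card_Iio

theorem encard_mem_Ioo_min_max_le (hm : Antitone m) (hmnn : ∀ k, 0 ≤ m k)
    (hsum : Summable m) (hθ1 : θ 0 < 1) (hf_anti : Antitone f)
    {t : ℝ} (ht : 0 < t)
    (hf : {k | t < f k}.encard =
        {k | k ≠ i ∧ t < m k}.encard + {k | t < θ k * m i}.encard) :
    {k | t ∈ Set.Ioo (min (f k) (m k)) (max (f k) (m k))}.encard ≤
      (if θ 0 * m i ≤ t ∧ t < m i then 1 else 0) + {k | t < θ (k + 1) * m i}.encard := by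
  classical
  have hfin : {k | t < m k}.Finite := by
    have := (hsum.tendsto_atTop_zero.eventually (gt_mem_nhds ht))
    rw [← Nat.cofinite_eq_atTop, Filter.eventually_cofinite] at this
    exact this.subset fun k hk => not_lt.2 (le_of_lt hk)
  have hBcard := encard_setOf_eq_add_ne (fun k => t < m k) i
  have hCcard := encard_succ_set (fun k => t < θ k * m i)
  have hD : {k | k ≠ i ∧ t < m k}.Finite := hfin.subset fun k hk => hk.2
  have h0 : t < θ 0 * m i → t < m i := fun h => h.trans_le (mul_le_of_le_one_left (hmnn i) hθ1.le)
  have hsub : {k | t < f k} ⊆ {k | t < m k} ∨ {k | t < m k} ⊆ {k | t < f k} := by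
    by_contra! h
    obtain ⟨h1, h2⟩ := h
    obtain ⟨a, ha, ha'⟩ := Set.not_subset.1 h1
    obtain ⟨b, hb, hb'⟩ := Set.not_subset.1 h2
    simp only [Set.mem_ofPred_eq, not_lt] at ha ha' hb hb'
    rcases le_total a b with h | h
    · have := hm h; linarith
    · have := hf_anti h; linarith
  rw [hCcard] at hf
  rw [hD.encard_eq_coe_toFinset_card] at hf hBcard
  rcases hsub with h | h
  · have hE : {k | t ∈ Set.Ioo (min (f k) (m k)) (max (f k) (m k))} ⊆
        {k | t < m k} \ {k | t < f k} := by
      intro k hk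
      have := @h k
      simp only [Set.mem_ofPred_eq, Set.mem_Ioo, min_lt_iff, lt_max_iff, Set.mem_sdiff] at hk this ⊢
      grind
    refine (Set.encard_le_encard hE).trans ?_
    have key := Set.encard_sdiff_add_encard_of_subset h
    rw [hf, hBcard] at key
    generalize ({k | t < m k} \ {k | t < f k}).encard = x at key ⊢
    generalize {k | t < θ (k + 1) * m i}.encard = c at key ⊢
    generalize hD.toFinset.card = n at key
    have hx : x ≠ ⊤ := by
      rintro rfl
      split_ifs at key <;> simp at key <;> exact absurd key.symm (by norm_cast)
    have hc : c ≠ ⊤ := by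
      rintro rfl
      split_ifs at key <;> simp at key <;> exact absurd key.symm (by norm_cast)
    lift x to ℕ using hx
    lift c to ℕ using hc
    split_ifs at key ⊢ <;> norm_cast at key ⊢ <;> grind
  · have hE : {k | t ∈ Set.Ioo (min (f k) (m k)) (max (f k) (m k))} ⊆
        {k | t < f k} \ {k | t < m k} := by
      intro k hk
      have := @h k
      simp only [Set.mem_ofPred_eq, Set.mem_Ioo, min_lt_iff, lt_max_iff, Set.mem_sdiff] at hk this ⊢
      grind
    refine (Set.encard_le_encard hE).trans ?_
    have key := Set.encard_sdiff_add_encard_of_subset h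
    rw [hf, hBcard] at key
    generalize ({k | t < f k} \ {k | t < m k}).encard = x at key ⊢
    generalize {k | t < θ (k + 1) * m i}.encard = c at key ⊢
    generalize hD.toFinset.card = n at key
    by_cases hc : c = ⊤
    · simp [hc]
    lift c to ℕ using hc
    have hx : x ≠ ⊤ := by
      rintro rfl
      split_ifs at key <;> simp at key <;> exact absurd key.symm (by norm_cast)
    lift x to ℕ using hx
    split_ifs at key ⊢ <;> norm_cast at key ⊢ <;> grind

/-- Unweighted version of the estimate: fragmentation moves the sequence by at most
`2 * (1 - θ 0) * m i` in `ℓ¹`. -/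
theorem tsum_ofReal_abs_sub_le (hm : Antitone m) (hmnn : ∀ k, 0 ≤ m k)
    (hsum : Summable m) (hθ1 : θ 0 < 1) (hθnn : ∀ k, 0 ≤ θ k)
    (hθsum : ∑' k, ENNReal.ofReal (θ k) ≤ 1)
    (hf_anti : Antitone f) (hfnn : ∀ k, 0 ≤ f k)
    (hf : ∀ t : ℝ, 0 < t →
      {k | t < f k}.encard =
        {k | k ≠ i ∧ t < m k}.encard + {k | t < θ k * m i}.encard) :
    ∑' k, ENNReal.ofReal |f k - m k| ≤ ENNReal.ofReal (2 * (1 - θ 0) * m i) := by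
  classical
  have tail : ∑' k, ENNReal.ofReal (θ (k + 1)) ≤ ENNReal.ofReal (1 - θ 0) := by
    rw [ENNReal.ofReal_sub _ (hθnn 0), ENNReal.ofReal_one]
    refine ENNReal.le_sub_of_add_le_left ENNReal.ofReal_ne_top ?_
    rwa [tsum_eq_zero_add' ENNReal.summable] at hθsum
  have pointwise : ∀ t : ℝ,
      ∑' k, (Set.Ioo (min (f k) (m k)) (max (f k) (m k))).indicator (fun _ => (1 : ENNReal)) t ≤
      (Set.Ico (θ 0 * m i) (m i)).indicator (fun _ => (1 : ENNReal)) t +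
        ∑' k, (Set.Ioo 0 (θ (k + 1) * m i)).indicator (fun _ => (1 : ENNReal)) t := by
    intro t
    rw [tsum_indicator_one_eq_encard_s19, tsum_indicator_one_eq_encard_s19]
    rcases le_or_gt t 0 with ht | ht
    · have : {k | t ∈ Set.Ioo (min (f k) (m k)) (max (f k) (m k))} = ∅ := by
        ext k
        have := le_min (hfnn k) (hmnn k)
        simp only [Set.mem_ofPred_eq, Set.mem_Ioo, Set.mem_empty_iff_false, iff_false, not_and]
        intro h
        linarith
      rw [this]
      simp
    · have := ENat.toENNReal_le.2
        (encard_mem_Ioo_min_max_le hm hmnn hsum hθ1 hf_anti ht (hf t ht))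
      refine this.trans (le_of_eq ?_)
      rw [ENat.toENNReal_add]
      congr 1
      · simp only [Set.indicator_apply, Set.mem_Ico]
        split_ifs <;> simp
      · simp [ht]
  calc ∑' k, ENNReal.ofReal |f k - m k|
      = ∑' k, ∫⁻ t, (Set.Ioo (min (f k) (m k)) (max (f k) (m k))).indicator
          (fun _ => (1 : ENNReal)) t := by
        refine tsum_congr fun k => ?_
        rw [lintegral_indicator measurableSet_Ioo, setLIntegral_one, volume_Ioo_min_max]
    _ = ∫⁻ t, ∑' k, (Set.Ioo (min (f k) (m k)) (max (f k) (m k))).indicator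
          (fun _ => (1 : ENNReal)) t :=
        (lintegral_tsum fun k =>
          (measurable_const.indicator measurableSet_Ioo).aemeasurable).symm
    _ ≤ ∫⁻ t, ((Set.Ico (θ 0 * m i) (m i)).indicator (fun _ => (1 : ENNReal)) t +
        ∑' k, (Set.Ioo 0 (θ (k + 1) * m i)).indicator (fun _ => (1 : ENNReal)) t) :=
        lintegral_mono pointwise
    _ = ENNReal.ofReal (m i - θ 0 * m i) + ∑' k, ENNReal.ofReal (θ (k + 1) * m i) := by
        rw [lintegral_add_left (measurable_const.indicator measurableSet_Ico),
          lintegral_indicator measurableSet_Ico, setLIntegral_one, Real.volume_Ico,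
          lintegral_tsum fun k =>
            (measurable_const.indicator measurableSet_Ioo).aemeasurable]
        congr 1
        refine tsum_congr fun k => ?_
        rw [lintegral_indicator measurableSet_Ioo, setLIntegral_one, Real.volume_Ioo, sub_zero]
    _ = ENNReal.ofReal ((1 - θ 0) * m i) +
          (∑' k, ENNReal.ofReal (θ (k + 1))) * ENNReal.ofReal (m i) := by
        rw [← ENNReal.tsum_mul_right]
        congr 2
        · ring
        · ext k
          exact ENNReal.ofReal_mul (hθnn _)
    _ ≤ ENNReal.ofReal ((1 - θ 0) * m i) + ENNReal.ofReal (1 - θ 0) * ENNReal.ofReal (m i) := by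
        gcongr
    _ = ENNReal.ofReal (2 * (1 - θ 0) * m i) := by
        have h1 : 0 ≤ 1 - θ 0 := by linarith
        have h2 := mul_nonneg h1 (hmnn i)
        rw [← ENNReal.ofReal_mul h1, ← ENNReal.ofReal_add h2 h2]
        congr 1
        ring

end Fragmentation

/-- Estimate (d1f): d(f_{iθ}(m), m) ≤ 2(1 − θ₁) 2^{−i} m_i. Here `f` is the
nonincreasing rearrangement of the family consisting of the entries m_k for k ≠ i
together with the fragments θ_k·m_i, encoded via extended cardinals of super-level
sets. Sequences and θ are indexed from 0 (`θ 0` is θ₁, and the 1-based weight 2^{−i}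
of the i-th particle becomes `(2⁻¹)^(i+1)` for the 0-based index i). -/
theorem stmt_19 (m : ℕ → ℝ) (hm : Antitone m) (hmnn : ∀ k, 0 ≤ m k)
    (hsum : Summable m)
    (i : ℕ)
    (θ : ℕ → ℝ) (hθ1 : θ 0 < 1) (hθanti : Antitone θ) (hθnn : ∀ k, 0 ≤ θ k)
    (hθsum : ∑' k, ENNReal.ofReal (θ k) ≤ 1)
    (f : ℕ → ℝ) (hf_anti : Antitone f) (hfnn : ∀ k, 0 ≤ f k)
    (hf : ∀ t : ℝ, 0 < t →
      {k | t < f k}.encard =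
        {k | k ≠ i ∧ t < m k}.encard + {k | t < θ k * m i}.encard) :
    ∑' k : ℕ, (2 : ℝ)⁻¹ ^ (k + 1) * |f k - m k| ≤
      2 * (1 - θ 0) * (2 : ℝ)⁻¹ ^ (i + 1) * m i := by
  have hθ : ∀ k, θ k ≤ 1 := fun k => (hθanti (Nat.zero_le k)).trans hθ1.le
  have hl1 := tsum_ofReal_abs_sub_le hm hmnn hsum hθ1 hθnn hθsum hf_anti hfnn hf
  have hR : 0 ≤ 2 * (1 - θ 0) * m i := mul_nonneg (by linarith) (hmnn i)
  refine Real.tsum_le_of_sum_range_le (fun k => by positivity) fun n => ?_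
  have hn : ∑ k ∈ Finset.range n, |f k - m k| ≤ 2 * (1 - θ 0) * m i := by
    rw [← ENNReal.ofReal_le_ofReal_iff hR,
      ENNReal.ofReal_sum_of_nonneg fun k _ => abs_nonneg _]
    exact (ENNReal.sum_le_tsum _).trans hl1
  calc ∑ k ∈ Finset.range n, (2 : ℝ)⁻¹ ^ (k + 1) * |f k - m k|
      ≤ ∑ k ∈ Finset.range n, (2 : ℝ)⁻¹ ^ (i + 1) * |f k - m k| := by
        refine Finset.sum_le_sum fun k _ => ?_
        rcases lt_or_ge k i with hk | hk
        · simp [rearrangement_eq_of_lt hm hmnn hθ hf_anti hfnn hf hk]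
        · exact mul_le_mul_of_nonneg_right
            (pow_le_pow_of_le_one (by norm_num) (by norm_num) (by omega)) (abs_nonneg _)
    _ = (2 : ℝ)⁻¹ ^ (i + 1) * ∑ k ∈ Finset.range n, |f k - m k| := (Finset.mul_sum ..).symm
    _ ≤ (2 : ℝ)⁻¹ ^ (i + 1) * (2 * (1 - θ 0) * m i) := by gcongr
    _ = 2 * (1 - θ 0) * (2 : ℝ)⁻¹ ^ (i + 1) * m i := by ring
end
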